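/- arXiv:math/0311381 — 3 statements merged into one kernel-verified Lean document; each statement's English description precedes it below -/
import Mathlib

section
/- Let H be a quasi-Hopf algebra over a field k, B a Hopf algebra in the braided category of left Yetter–Drinfeld modules over H, and M a right B-Hopf module in this category. Then the space of coinvariants M^coB = {m∈M : ρ_M(m)=m⊗1_B} is a left Yetter–Drinfeld submodule of M: it is stable under the left H-action, and the left H-coaction λ_M maps M^coB into H⊗M^coB. -/
open scoped TensorProduct

noncomputable section

/-- A quasi-bialgebra `(H, Δ, ε, Φ)` over a field `k`.  The comultiplication is
given both as an algebra map `Δmap : H →ₐ[k] H ⊗[k] H` and by a finite family of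
Sweedler components `Δ1, Δ2` (linked by `Δ_eq`); the reassociator `Φ` and its
inverse are given by finite families of components `X1, X2, X3` resp. `x1, x2, x3`. -/
structure QuasiBialgebra (k H : Type) [Field k] [Ring H] [Algebra k H] where
  /-- index type for the Sweedler components of `Δ` -/
  J : Type
  [fJ : Fintype J]
  Δ1 : H → J → H
  Δ2 : H → J → H
  Δmap : H →ₐ[k] H ⊗[k] H
  ε : H →ₐ[k] k
  Δ_eq : ∀ h, Δmap h = ∑ j, Δ1 h j ⊗ₜ[k] Δ2 h j
  /-- index type for the components of `Φ` -/
  I : Type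
  [fI : Fintype I]
  X1 : I → H
  X2 : I → H
  X3 : I → H
  /-- index type for the components of `Φ⁻¹` -/
  I' : Type
  [fI' : Fintype I']
  x1 : I' → H
  x2 : I' → H
  x3 : I' → H
  Φ_right_inv :
    (∑ i, X1 i ⊗ₜ[k] (X2 i ⊗ₜ[k] X3 i)) * (∑ a, x1 a ⊗ₜ[k] (x2 a ⊗ₜ[k] x3 a)) = 1
  Φ_left_inv :
    (∑ a, x1 a ⊗ₜ[k] (x2 a ⊗ₜ[k] x3 a)) * (∑ i, X1 i ⊗ₜ[k] (X2 i ⊗ₜ[k] X3 i)) = 1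
  quasi_coassoc : ∀ h,
    ∑ j, ∑ j', Δ1 h j ⊗ₜ[k] (Δ1 (Δ2 h j) j' ⊗ₜ[k] Δ2 (Δ2 h j) j')
      = (∑ i, X1 i ⊗ₜ[k] (X2 i ⊗ₜ[k] X3 i))
        * (∑ j, ∑ j', Δ1 (Δ1 h j) j' ⊗ₜ[k] (Δ2 (Δ1 h j) j' ⊗ₜ[k] Δ2 h j))
        * (∑ a, x1 a ⊗ₜ[k] (x2 a ⊗ₜ[k] x3 a))
  counit_right : ∀ h, ∑ j, ε (Δ2 h j) • Δ1 h j = h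
  counit_left : ∀ h, ∑ j, ε (Δ1 h j) • Δ2 h j = h
  cocycle :
    (∑ i, (1 : H) ⊗ₜ[k] (X1 i ⊗ₜ[k] (X2 i ⊗ₜ[k] X3 i)))
      * (∑ i, ∑ j, X1 i ⊗ₜ[k] (Δ1 (X2 i) j ⊗ₜ[k] (Δ2 (X2 i) j ⊗ₜ[k] X3 i)))
      * (∑ i, X1 i ⊗ₜ[k] (X2 i ⊗ₜ[k] (X3 i ⊗ₜ[k] (1 : H))))
    = (∑ i, ∑ j, X1 i ⊗ₜ[k] (X2 i ⊗ₜ[k] (Δ1 (X3 i) j ⊗ₜ[k] Δ2 (X3 i) j)))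
      * (∑ i, ∑ j, Δ1 (X1 i) j ⊗ₜ[k] (Δ2 (X1 i) j ⊗ₜ[k] (X2 i ⊗ₜ[k] X3 i)))
  Φ_normal : ∑ i, ε (X2 i) • (X1 i ⊗ₜ[k] X3 i) = (1 : H ⊗[k] H)

attribute [instance] QuasiBialgebra.fJ QuasiBialgebra.fI QuasiBialgebra.fI'

/-- A quasi-Hopf algebra: a quasi-bialgebra together with a bijective algebra
anti-automorphism `S` (with inverse `Sinv`) and elements `α, β` satisfying the
antipode axioms. -/
structure QuasiHopf (k H : Type) [Field k] [Ring H] [Algebra k H] extends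
    QuasiBialgebra k H where
  S : H →ₗ[k] H
  Sinv : H →ₗ[k] H
  Sinv_S : ∀ h, Sinv (S h) = h
  S_Sinv : ∀ h, S (Sinv h) = h
  S_one : S 1 = 1
  S_mul : ∀ a b, S (a * b) = S b * S a
  α : H
  β : H
  antipode₁ : ∀ h, ∑ j, S (Δ1 h j) * α * Δ2 h j = ε h • α
  antipode₂ : ∀ h, ∑ j, Δ1 h j * β * S (Δ2 h j) = ε h • β
  antipode₃ : ∑ i, X1 i * β * S (X2 i) * α * X3 i = 1
  antipode₄ : ∑ a, S (x1 a) * α * x2 a * β * S (x3 a) = 1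

namespace QuasiHopf

variable {k H : Type} [Field k] [Ring H] [Algebra k H] (Q : QuasiHopf k H)

/-- index type for `∑ A¹⊗A²⊗A³⊗A⁴ = (Φ⊗1)(Δ⊗id⊗id)(Φ⁻¹)` -/
abbrev AIdx := Q.I × Q.I' × Q.J

def A1 (t : Q.AIdx) : H := Q.X1 t.1 * Q.Δ1 (Q.x1 t.2.1) t.2.2
def A2 (t : Q.AIdx) : H := Q.X2 t.1 * Q.Δ2 (Q.x1 t.2.1) t.2.2
def A3 (t : Q.AIdx) : H := Q.X3 t.1 * Q.x2 t.2.1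
def A4 (t : Q.AIdx) : H := Q.x3 t.2.1

/-- index type for `∑ B¹⊗B²⊗B³⊗B⁴ = (Δ⊗id⊗id)(Φ)(Φ⁻¹⊗1)` -/
abbrev BIdx := Q.I × Q.J × Q.I'

def B1 (t : Q.BIdx) : H := Q.Δ1 (Q.X1 t.1) t.2.1 * Q.x1 t.2.2
def B2 (t : Q.BIdx) : H := Q.Δ2 (Q.X1 t.1) t.2.1 * Q.x2 t.2.2
def B3 (t : Q.BIdx) : H := Q.X2 t.1 * Q.x3 t.2.2
def B4 (t : Q.BIdx) : H := Q.X3 t.1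

/-- `γ = ∑ S(A²)αA³ ⊗ S(A¹)αA⁴` -/
def gam1 (t : Q.AIdx) : H := Q.S (Q.A2 t) * Q.α * Q.A3 t
def gam2 (t : Q.AIdx) : H := Q.S (Q.A1 t) * Q.α * Q.A4 t

/-- `δ = ∑ B¹βS(B⁴) ⊗ B²βS(B³)` -/
def del1 (t : Q.BIdx) : H := Q.B1 t * Q.β * Q.S (Q.B4 t)
def del2 (t : Q.BIdx) : H := Q.B2 t * Q.β * Q.S (Q.B3 t)

/-- index type for the components of the Drinfeld twist
`f = ∑ (S⊗S)(Δᵒᵖ(x¹)) γ Δ(x²βS(x³))` -/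
abbrev FIdx := Q.I' × Q.J × Q.AIdx × Q.J

def f1 (t : Q.FIdx) : H :=
  Q.S (Q.Δ2 (Q.x1 t.1) t.2.1) * Q.gam1 t.2.2.1
    * Q.Δ1 (Q.x2 t.1 * Q.β * Q.S (Q.x3 t.1)) t.2.2.2
def f2 (t : Q.FIdx) : H :=
  Q.S (Q.Δ1 (Q.x1 t.1) t.2.1) * Q.gam2 t.2.2.1
    * Q.Δ2 (Q.x2 t.1 * Q.β * Q.S (Q.x3 t.1)) t.2.2.2

/-- index type for the components of
`f⁻¹ = ∑ Δ(S(x¹)αx²) δ (S⊗S)(Δᵒᵖ(x³))` -/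
abbrev GIdx := Q.I' × Q.J × Q.BIdx × Q.J

def g1 (t : Q.GIdx) : H :=
  Q.Δ1 (Q.S (Q.x1 t.1) * Q.α * Q.x2 t.1) t.2.1 * Q.del1 t.2.2.1
    * Q.S (Q.Δ2 (Q.x3 t.1) t.2.2.2)
def g2 (t : Q.GIdx) : H :=
  Q.Δ2 (Q.S (Q.x1 t.1) * Q.α * Q.x2 t.1) t.2.1 * Q.del2 t.2.2.1
    * Q.S (Q.Δ1 (Q.x3 t.1) t.2.2.2)

/-- `q_R = ∑ X¹ ⊗ S⁻¹(αX³)X²` -/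
def q1 (i : Q.I) : H := Q.X1 i
def q2 (i : Q.I) : H := Q.Sinv (Q.α * Q.X3 i) * Q.X2 i

/-- `p_R = ∑ x¹ ⊗ x²βS(x³)` -/
def p1 (a : Q.I') : H := Q.x1 a
def p2 (a : Q.I') : H := Q.x2 a * Q.β * Q.S (Q.x3 a)

/-- `p_L = ∑ X²S⁻¹(X¹β) ⊗ X³` -/
def pL1 (i : Q.I) : H := Q.X2 i * Q.Sinv (Q.X1 i * Q.β)
def pL2 (i : Q.I) : H := Q.X3 i

/-- `q_L = ∑ S(x¹)αx² ⊗ x³` -/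
def qL1 (a : Q.I') : H := Q.S (Q.x1 a) * Q.α * Q.x2 a
def qL2 (a : Q.I') : H := Q.x3 a

end QuasiHopf

section BraidedYD

variable {k H : Type} [Field k] [Ring H] [Algebra k H]

/-- the linear map `h ↦ A * h * C` on `H` -/
def lrH (k : Type) [Field k] {H : Type} [Ring H] [Algebra k H] (A C : H) :
    H →ₗ[k] H :=
  (LinearMap.mulLeft k A).comp (LinearMap.mulRight k C)

/-- the linear map `h ⊗ h' ↦ A * h * C * h' * E` on `H ⊗ H` -/
def sandwichLift (k : Type) [Field k] {H : Type} [Ring H] [Algebra k H]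
    (A C E : H) : H ⊗[k] H →ₗ[k] H :=
  TensorProduct.lift
    (((LinearMap.mul k H).compl₂ (LinearMap.mulRight k E)).comp
      ((LinearMap.mulLeft k A).comp (LinearMap.mulRight k C)))

variable {M : Type} [AddCommGroup M] [Module k M]

/-- A left Yetter-Drinfeld module over a quasi-bialgebra `Q`: a left `H`-module
(action `act`) with a left `H`-coaction `coact : M →ₗ H ⊗ M`,
`m ↦ ∑ m₍₋₁₎ ⊗ m₍₀₎`, satisfying (y1), (y2), (y3). -/
structure IsLeftYD (Q : QuasiBialgebra k H)
    (act : H →ₗ[k] M →ₗ[k] M) (coact : M →ₗ[k] H ⊗[k] M) : Prop where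
  one_act : act 1 = LinearMap.id
  mul_act : ∀ g h, act (g * h) = (act g).comp (act h)
  /-- `∑ X¹m₍₋₁₎ ⊗ (X²·m₍₀₎)₍₋₁₎X³ ⊗ (X²·m₍₀₎)₍₀₎
      = ∑ X¹(Y¹·m)₍₋₁₎₁Y² ⊗ X²(Y¹·m)₍₋₁₎₂Y³ ⊗ X³·(Y¹·m)₍₀₎` -/
  yd1 : ∀ m,
    ∑ i, (TensorProduct.map (LinearMap.mulLeft k (Q.X1 i))
        (TensorProduct.map (LinearMap.mulRight k (Q.X3 i)) LinearMap.id))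
        ((LinearMap.lTensor H (coact.comp (act (Q.X2 i)))) (coact m))
    = ∑ i, ∑ i2, (TensorProduct.assoc k H H M)
        ((TensorProduct.map
          (TensorProduct.map (lrH k (Q.X1 i) (Q.X2 i2)) (lrH k (Q.X2 i) (Q.X3 i2)))
          (act (Q.X3 i)))
          ((LinearMap.rTensor M Q.Δmap.toLinearMap) (coact (act (Q.X1 i2) m))))
  /-- `∑ ε(m₍₋₁₎) m₍₀₎ = m` -/
  yd2 : ∀ m,
    (TensorProduct.lid k M) ((LinearMap.rTensor M Q.ε.toLinearMap) (coact m)) = m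
  /-- `∑ h₁m₍₋₁₎ ⊗ h₂·m₍₀₎ = ∑ (h₁·m)₍₋₁₎h₂ ⊗ (h₁·m)₍₀₎` -/
  yd3 : ∀ h m,
    ∑ j, (TensorProduct.map (LinearMap.mulLeft k (Q.Δ1 h j)) (act (Q.Δ2 h j))) (coact m)
    = ∑ j, (LinearMap.rTensor M (LinearMap.mulRight k (Q.Δ2 h j)))
        (coact (act (Q.Δ1 h j) m))

/-- The data of a bialgebra `B` in the braided category of left Yetter-Drinfeld
modules over a quasi-bialgebra `Q`: the `H`-action, the `H`-coaction (as a linear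
map and via a finite family of components `cm1, cm0`), the multiplication, unit,
comultiplication (as a linear map and via components `D1, D2`) and counit. -/
structure BialgData {k H : Type} [Field k] [Ring H] [Algebra k H]
    (Q : QuasiBialgebra k H) (B : Type) [AddCommGroup B] [Module k B] where
  act : H →ₗ[k] B →ₗ[k] B
  coact : B →ₗ[k] H ⊗[k] B
  /-- index type for the components of the `H`-coaction -/
  KB : Type
  [fKB : Fintype KB]
  cm1 : B → KB → H
  cm0 : B → KB → B
  mul : B →ₗ[k] B →ₗ[k] B
  one : B
  comul : B →ₗ[k] B ⊗[k] B
  /-- index type for the components of the comultiplication -/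
  LB : Type
  [fLB : Fintype LB]
  D1 : B → LB → B
  D2 : B → LB → B
  counit : B →ₗ[k] k

attribute [instance] BialgData.fKB BialgData.fLB

variable {B : Type} [AddCommGroup B] [Module k B]

/-- `B` (with data `D`) is a bialgebra in the braided category of left
Yetter-Drinfeld modules over `Q`. -/
structure IsBialgebraInYD (Q : QuasiBialgebra k H) (D : BialgData Q B) : Prop where
  yd : IsLeftYD Q D.act D.coact
  coact_eq : ∀ b, D.coact b = ∑ κ, D.cm1 b κ ⊗ₜ[k] D.cm0 b κ
  comul_eq : ∀ b, D.comul b = ∑ l, D.D1 b l ⊗ₜ[k] D.D2 b l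
  /-- `(ab)c = ∑ (X¹·a)[(X²·b)(X³·c)]` -/
  mul_assoc : ∀ a b c, D.mul (D.mul a b) c
    = ∑ i, D.mul (D.act (Q.X1 i) a) (D.mul (D.act (Q.X2 i) b) (D.act (Q.X3 i) c))
  one_mul : ∀ b, D.mul D.one b = b
  mul_one : ∀ b, D.mul b D.one = b
  /-- `h·(ab) = ∑ (h₁·a)(h₂·b)` -/
  act_mul : ∀ h a b, D.act h (D.mul a b)
    = ∑ j, D.mul (D.act (Q.Δ1 h j) a) (D.act (Q.Δ2 h j) b)
  act_one : ∀ h, D.act h D.one = Q.ε h • D.one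
  /-- `λ_B(bb') = ∑ X¹(x¹Y¹·b)₍₋₁₎x²(Y²·b')₍₋₁₎Y³
        ⊗ [X²·(x¹Y¹·b)₍₀₎][X³x³·(Y²·b')₍₀₎]` -/
  coact_mul : ∀ b b', D.coact (D.mul b b')
    = ∑ i, ∑ a, ∑ i2, ∑ κ, ∑ κ',
        (Q.X1 i * D.cm1 (D.act (Q.x1 a * Q.X1 i2) b) κ * Q.x2 a
            * D.cm1 (D.act (Q.X2 i2) b') κ' * Q.X3 i2)
          ⊗ₜ[k] D.mul (D.act (Q.X2 i) (D.cm0 (D.act (Q.x1 a * Q.X1 i2) b) κ))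
            (D.act (Q.X3 i * Q.x3 a) (D.cm0 (D.act (Q.X2 i2) b') κ'))
  coact_one : D.coact D.one = (1 : H) ⊗ₜ[k] D.one
  /-- `∑ X¹·b₍1,1₎ ⊗ X²·b₍1,2₎ ⊗ X³·b₍2₎ = ∑ b₍1₎ ⊗ b₍2,1₎ ⊗ b₍2,2₎` -/
  comul_coassoc : ∀ b,
    ∑ i, (TensorProduct.map (TensorProduct.map (D.act (Q.X1 i)) (D.act (Q.X2 i)))
        (D.act (Q.X3 i))) ((LinearMap.rTensor B D.comul) (D.comul b))
    = (TensorProduct.assoc k B B B).symm ((LinearMap.lTensor B D.comul) (D.comul b))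
  comul_act : ∀ h b, D.comul (D.act h b)
    = ∑ j, (TensorProduct.map (D.act (Q.Δ1 h j)) (D.act (Q.Δ2 h j))) (D.comul b)
  counit_act : ∀ h b, D.counit (D.act h b) = Q.ε h * D.counit b
  comul_counit_right : ∀ b,
    (TensorProduct.rid k B) ((LinearMap.lTensor B D.counit) (D.comul b)) = b
  comul_counit_left : ∀ b,
    (TensorProduct.lid k B) ((LinearMap.rTensor B D.counit) (D.comul b)) = b
  /-- `Δ_B` is `H`-colinear -/
  comul_colinear : ∀ b, (LinearMap.lTensor H D.comul) (D.coact b)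
    = ∑ i, ∑ a, ∑ i2, ∑ l, ∑ κ, ∑ κ',
        (Q.X1 i * D.cm1 (D.act (Q.x1 a * Q.X1 i2) (D.D1 b l)) κ * Q.x2 a
            * D.cm1 (D.act (Q.X2 i2) (D.D2 b l)) κ' * Q.X3 i2)
          ⊗ₜ[k] ((D.act (Q.X2 i) (D.cm0 (D.act (Q.x1 a * Q.X1 i2) (D.D1 b l)) κ))
            ⊗ₜ[k] (D.act (Q.X3 i * Q.x3 a) (D.cm0 (D.act (Q.X2 i2) (D.D2 b l)) κ')))
  /-- `∑ ε_B(b₍₀₎) b₍₋₁₎ = ε_B(b) 1` -/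
  counit_colinear : ∀ b, ∑ κ, D.counit (D.cm0 b κ) • D.cm1 b κ = D.counit b • (1 : H)
  comul_one : D.comul D.one = D.one ⊗ₜ[k] D.one
  /-- braided multiplicativity of `Δ_B`:
  `Δ_B(bb') = ∑ [y¹X¹·b₍1₎][y²Y¹(x¹X²·b₍2₎)₍₋₁₎x²X³₁·b'₍1₎]
      ⊗ [y³₁Y²·(x¹X²·b₍2₎)₍₀₎][y³₂Y³x³X³₂·b'₍2₎]` -/
  comul_mul : ∀ b b', D.comul (D.mul b b')
    = ∑ a, ∑ i, ∑ i2, ∑ a2, ∑ j, ∑ j2, ∑ l, ∑ l', ∑ κ,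
        D.mul (D.act (Q.x1 a * Q.X1 i) (D.D1 b l))
          (D.act (Q.x2 a * Q.X1 i2 * D.cm1 (D.act (Q.x1 a2 * Q.X2 i) (D.D2 b l)) κ
              * Q.x2 a2 * Q.Δ1 (Q.X3 i) j) (D.D1 b' l'))
        ⊗ₜ[k] D.mul
          (D.act (Q.Δ1 (Q.x3 a) j2 * Q.X2 i2)
            (D.cm0 (D.act (Q.x1 a2 * Q.X2 i) (D.D2 b l)) κ))
          (D.act (Q.Δ2 (Q.x3 a) j2 * Q.X3 i2 * Q.x3 a2 * Q.Δ2 (Q.X3 i) j) (D.D2 b' l'))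

/-- `B` (with data `D` and antipode `Sb`) is a Hopf algebra in the braided
category of left Yetter-Drinfeld modules over `Q`. -/
structure IsBraidedHopf (Q : QuasiBialgebra k H) (D : BialgData Q B)
    (Sb : B →ₗ[k] B) : Prop where
  bialg : IsBialgebraInYD Q D
  antipode_Hlinear : ∀ h b, Sb (D.act h b) = D.act h (Sb b)
  antipode_colinear : ∀ b, D.coact (Sb b) = (LinearMap.lTensor H Sb) (D.coact b)
  antipode_left : ∀ b, ∑ l, D.mul (Sb (D.D1 b l)) (D.D2 b l) = D.counit b • D.one
  antipode_right : ∀ b, ∑ l, D.mul (D.D1 b l) (Sb (D.D2 b l)) = D.counit b • D.one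

/-- `M` is a right `B`-Hopf module in the braided category of left
Yetter-Drinfeld modules over `Q`:  a Yetter-Drinfeld module `(actM, coactM)`
with an `H`-linear, `H`-colinear right `B`-action `ract` and an `H`-linear,
`H`-colinear, counital, quasi-coassociative right `B`-coaction `rcoact` which is
right `B`-linear in the braided sense. -/
structure IsRightBHopfModule (Q : QuasiBialgebra k H) (D : BialgData Q B)
    (actM : H →ₗ[k] M →ₗ[k] M) (coactM : M →ₗ[k] H ⊗[k] M)
    (ract : B →ₗ[k] M →ₗ[k] M) (rcoact : M →ₗ[k] M ⊗[k] B) : Prop where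
  yd : IsLeftYD Q actM coactM
  /-- `m ← 1_B = m` -/
  ract_one : ∀ m, ract D.one m = m
  /-- `(m←b)←b' = ∑ (X¹·m)←[(X²·b)(X³·b')]` -/
  ract_assoc : ∀ m b b', ract b' (ract b m)
    = ∑ i, ract (D.mul (D.act (Q.X2 i) b) (D.act (Q.X3 i) b')) (actM (Q.X1 i) m)
  /-- `h·(m←b) = ∑ (h₁·m)←(h₂·b)` -/
  ract_Hlinear : ∀ h b m, actM h (ract b m)
    = ∑ j, ract (D.act (Q.Δ2 h j) b) (actM (Q.Δ1 h j) m)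
  /-- `λ_M(m←b) = ∑ X¹(x¹Y¹·m)₍₋₁₎x²(Y²·b)₍₋₁₎Y³
      ⊗ [X²·(x¹Y¹·m)₍₀₎]←[X³x³·(Y²·b)₍₀₎]` -/
  ract_Hcolinear : ∀ m b, coactM (ract b m)
    = ∑ i, ∑ a, ∑ i2, ∑ κ,
        (TensorProduct.map
          (lrH k (Q.X1 i) (Q.x2 a * D.cm1 (D.act (Q.X2 i2) b) κ * Q.X3 i2))
          ((ract (D.act (Q.X3 i * Q.x3 a) (D.cm0 (D.act (Q.X2 i2) b) κ))).comp
            (actM (Q.X2 i))))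
          (coactM (actM (Q.x1 a * Q.X1 i2) m))
  /-- `ρ_M(h·m) = ∑ h₁·m₍0₎ ⊗ h₂·m₍1₎` -/
  rcoact_Hlinear : ∀ h m, rcoact (actM h m)
    = ∑ j, (TensorProduct.map (actM (Q.Δ1 h j)) (D.act (Q.Δ2 h j))) (rcoact m)
  /-- `∑ m₍₋₁₎ ⊗ ρ_M(m₍₀₎) = ∑ X¹(x¹Y¹·m₍0₎)₍₋₁₎x²(Y²·m₍1₎)₍₋₁₎Y³
      ⊗ X²·(x¹Y¹·m₍0₎)₍₀₎ ⊗ X³x³·(Y²·m₍1₎)₍₀₎` -/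
  rcoact_Hcolinear : ∀ m, (LinearMap.lTensor H rcoact) (coactM m)
    = ∑ i, ∑ a, ∑ i2,
        (TensorProduct.map (sandwichLift k (Q.X1 i) (Q.x2 a) (Q.X3 i2))
          (TensorProduct.map (actM (Q.X2 i)) (D.act (Q.X3 i * Q.x3 a))))
          ((TensorProduct.tensorTensorTensorComm k H M H B)
            ((TensorProduct.map (coactM.comp (actM (Q.x1 a * Q.X1 i2)))
              (D.coact.comp (D.act (Q.X2 i2)))) (rcoact m)))
  /-- `∑ X¹·m₍0,0₎ ⊗ X²·m₍0,1₎ ⊗ X³·m₍1₎ = ∑ m₍0₎ ⊗ (m₍1₎)₍1₎ ⊗ (m₍1₎)₍2₎` -/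
  rcoact_coassoc : ∀ m,
    ∑ i, (TensorProduct.map (TensorProduct.map (actM (Q.X1 i)) (D.act (Q.X2 i)))
        (D.act (Q.X3 i))) ((LinearMap.rTensor B rcoact) (rcoact m))
    = (TensorProduct.assoc k M B B).symm ((LinearMap.lTensor M D.comul) (rcoact m))
  /-- `∑ ε_B(m₍1₎) m₍0₎ = m` -/
  rcoact_counit : ∀ m,
    (TensorProduct.rid k M) ((LinearMap.lTensor M D.counit) (rcoact m)) = m
  /-- `ρ_M(m←b) = ∑ (y¹X¹·m₍0₎)←[y²Y¹(x¹X²·m₍1₎)₍₋₁₎x²X³₁·b₍1₎]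
      ⊗ [y³₁Y²·(x¹X²·m₍1₎)₍₀₎][y³₂Y³x³X³₂·b₍2₎]` -/
  rcoact_ract : ∀ m b, rcoact (ract b m)
    = ∑ a, ∑ i, ∑ i2, ∑ a2, ∑ j, ∑ j2, ∑ l,
        (TensorProduct.map
          (TensorProduct.lift
            (((ract.comp ((D.act.flip (D.D1 b l)).comp
                (lrH k (Q.x2 a * Q.X1 i2) (Q.x2 a2 * Q.Δ1 (Q.X3 i) j)))).flip).comp
              (actM (Q.x1 a * Q.X1 i))))
          ((D.mul.flip (D.act (Q.Δ2 (Q.x3 a) j2 * Q.X3 i2 * Q.x3 a2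
              * Q.Δ2 (Q.X3 i) j) (D.D2 b l))).comp
            (D.act (Q.Δ1 (Q.x3 a) j2 * Q.X2 i2))))
          ((TensorProduct.assoc k M H B).symm
            ((LinearMap.lTensor M (D.coact.comp (D.act (Q.x1 a2 * Q.X2 i))))
              (rcoact m)))

end BraidedYD

section HopfModuleCoinv

variable {k H : Type} [Field k] [Ring H] [Algebra k H]
variable {Q : QuasiBialgebra k H}
variable {B : Type} [AddCommGroup B] [Module k B]
variable {M : Type} [AddCommGroup M] [Module k M]

/-- the coinvariants `M^{co B} = {m ∈ M | ρ_M(m) = m ⊗ 1_B}` of a right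
`B`-Hopf module -/
def coinvariants (D : BialgData Q B) (rcoact : M →ₗ[k] M ⊗[k] B) :
    Submodule k M :=
  LinearMap.ker (rcoact - (TensorProduct.mk k M B).flip D.one)

/-- the projection `P(m) = ∑ m₍0₎ ← S̲(m₍1₎)` of a right `B`-Hopf module -/
def coinvProj (Sb : B →ₗ[k] B) (ract : B →ₗ[k] M →ₗ[k] M)
    (rcoact : M →ₗ[k] M ⊗[k] B) : M →ₗ[k] M :=
  (TensorProduct.lift ((ract.comp Sb).flip)).comp rcoact

end HopfModuleCoinv

section Counit

variable {k H : Type} [Field k] [Ring H] [Algebra k H]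

/-- A bilinear map evaluated on the components of a weighted tensor equal to `1 ⊗ 1`. -/
theorem sum_smul_bilin_eq_of_sum_tmul_eq_one {ι V : Type} [Fintype ι] [AddCommGroup V] [Module k V]
    {c : ι → k} {p q : ι → H} (h : ∑ i, c i • (p i ⊗ₜ[k] q i) = (1 : H ⊗[k] H))
    (f : H →ₗ[k] H →ₗ[k] V) : ∑ i, c i • f (p i) (q i) = f 1 1 := by
  simpa [Algebra.TensorProduct.one_def] using congrArg (TensorProduct.lift f) h

/-- The map `id ⊗ id ⊗ ε` on `H ⊗ H ⊗ H`. -/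
def counitThird (ε : H →ₐ[k] k) : H ⊗[k] (H ⊗[k] H) →ₐ[k] H ⊗[k] H :=
  Algebra.TensorProduct.map (AlgHom.id k H)
    ((Algebra.TensorProduct.rid k k H).toAlgHom.comp
      (Algebra.TensorProduct.map (AlgHom.id k H) ε))

@[simp] theorem counitThird_tmul (ε : H →ₐ[k] k) (a b c : H) :
    counitThird ε (a ⊗ₜ[k] (b ⊗ₜ[k] c)) = ε c • (a ⊗ₜ[k] b) := by
  simp [counitThird]

/-- The map `id ⊗ id ⊗ ε ⊗ id` on `H ⊗ H ⊗ H ⊗ H`. -/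
def counitThirdOfFour (ε : H →ₐ[k] k) :
    H ⊗[k] (H ⊗[k] (H ⊗[k] H)) →ₐ[k] H ⊗[k] (H ⊗[k] H) :=
  Algebra.TensorProduct.map (AlgHom.id k H)
    (Algebra.TensorProduct.map (AlgHom.id k H)
      ((Algebra.TensorProduct.lid k H).toAlgHom.comp
        (Algebra.TensorProduct.map ε (AlgHom.id k H))))

@[simp] theorem counitThirdOfFour_tmul (ε : H →ₐ[k] k) (a b c d : H) :
    counitThirdOfFour ε (a ⊗ₜ[k] (b ⊗ₜ[k] (c ⊗ₜ[k] d))) = a ⊗ₜ[k] (b ⊗ₜ[k] (ε c • d)) := by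
  simp [counitThirdOfFour]

namespace QuasiBialgebra

variable (Q : QuasiBialgebra k H)

/-- `(id ⊗ id ⊗ ε)(Φ) = 1 ⊗ 1` -/
theorem Φ_normal_right : ∑ i, Q.ε (Q.X3 i) • (Q.X1 i ⊗ₜ[k] Q.X2 i) = (1 : H ⊗[k] H) := by
  have hc := congrArg (counitThirdOfFour Q.ε) Q.cocycle
  simp only [map_mul, map_sum, counitThirdOfFour_tmul] at hc
  have h1 : ∑ i, (1 : H) ⊗ₜ[k] (Q.X1 i ⊗ₜ[k] (Q.ε (Q.X2 i) • Q.X3 i)) = 1 := by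
    have := congrArg (TensorProduct.mk k H (H ⊗[k] H) 1) Q.Φ_normal
    simpa [Algebra.TensorProduct.one_def] using this
  have h2 : ∑ i, ∑ j, Q.X1 i ⊗ₜ[k] (Q.Δ1 (Q.X2 i) j ⊗ₜ[k] (Q.ε (Q.Δ2 (Q.X2 i) j) • Q.X3 i))
      = ∑ i, Q.X1 i ⊗ₜ[k] (Q.X2 i ⊗ₜ[k] Q.X3 i) := by
    refine Finset.sum_congr rfl fun i _ => ?_
    conv_rhs => rw [← Q.counit_right (Q.X2 i)]
    simp only [TensorProduct.sum_tmul, TensorProduct.tmul_sum, TensorProduct.smul_tmul]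
  have h3 : ∑ i, ∑ j, Q.X1 i ⊗ₜ[k] (Q.X2 i ⊗ₜ[k] (Q.ε (Q.Δ1 (Q.X3 i) j) • Q.Δ2 (Q.X3 i) j))
      = ∑ i, Q.X1 i ⊗ₜ[k] (Q.X2 i ⊗ₜ[k] Q.X3 i) := by
    refine Finset.sum_congr rfl fun i _ => ?_
    conv_rhs => rw [← Q.counit_left (Q.X3 i)]
    simp only [TensorProduct.tmul_sum]
  have h4 : ∑ i, ∑ j, Q.Δ1 (Q.X1 i) j ⊗ₜ[k] (Q.Δ2 (Q.X1 i) j ⊗ₜ[k] (Q.ε (Q.X2 i) • Q.X3 i))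
      = 1 := by
    have := congrArg ((Algebra.TensorProduct.assoc k k k H H H).toAlgHom.comp
      (Algebra.TensorProduct.map Q.Δmap (AlgHom.id k H))) Q.Φ_normal
    rw [map_one] at this
    rw [← this]
    simp [Q.Δ_eq, TensorProduct.sum_tmul, Finset.smul_sum]
  rw [h1, h2, h3, h4, one_mul, mul_one] at hc
  have h5 := congrArg (fun t =>
    (∑ a, Q.x1 a ⊗ₜ[k] (Q.x2 a ⊗ₜ[k] Q.x3 a)) * t) hc
  simp only [← mul_assoc, Q.Φ_left_inv, one_mul] at h5
  simpa using congrArg (counitThird Q.ε) h5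

/-- `(id ⊗ id ⊗ ε)(Φ⁻¹) = 1 ⊗ 1` -/
theorem Φ_inv_normal_right :
    ∑ a, Q.ε (Q.x3 a) • (Q.x1 a ⊗ₜ[k] Q.x2 a) = (1 : H ⊗[k] H) := by
  simpa [map_sum, Q.Φ_normal_right] using congrArg (counitThird Q.ε) Q.Φ_left_inv

end QuasiBialgebra

end Counit

section Coinvariants

variable {k H : Type} [Field k] [Ring H] [Algebra k H] {Q : QuasiBialgebra k H}
variable {B : Type} [AddCommGroup B] [Module k B] {D : BialgData Q B}
variable {M : Type} [AddCommGroup M] [Module k M]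

theorem mem_coinvariants {rcoact : M →ₗ[k] M ⊗[k] B} {m : M} :
    m ∈ coinvariants D rcoact ↔ rcoact m = m ⊗ₜ[k] D.one := by
  simp [coinvariants, sub_eq_zero]

/-- The bilinear map `(p, q) ↦ ∑ A(p·m)₍₋₁₎q ⊗ C·(p·m)₍₀₎`. -/
def twistedCoact (actM : H →ₗ[k] M →ₗ[k] M) (coactM : M →ₗ[k] H ⊗[k] M) (A C : H) (m : M) :
    H →ₗ[k] H →ₗ[k] H ⊗[k] M :=
  LinearMap.mk₂ k
    (fun p q => TensorProduct.map (lrH k A q) (actM C) (coactM (actM p m)))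
    (by intros; simp)
    (by intros; simp)
    (by
      intro p q q'
      rw [← LinearMap.add_apply, ← TensorProduct.map_add_left]
      congr 2
      ext
      simp [lrH, mul_add])
    (by
      intro c p q
      rw [← LinearMap.smul_apply, ← TensorProduct.map_smul_left]
      congr 2
      ext
      simp [lrH])

@[simp] theorem twistedCoact_apply (actM : H →ₗ[k] M →ₗ[k] M) (coactM : M →ₗ[k] H ⊗[k] M)
    (A C : H) (m : M) (p q : H) : twistedCoact actM coactM A C m p q
      = TensorProduct.map (lrH k A q) (actM C) (coactM (actM p m)) := rfl

/-- The bilinear map `(p, q) ↦ ∑ p u¹ ⊗ q·u²` for `u ∈ H ⊗ M`. -/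
def tensorAct (actM : H →ₗ[k] M →ₗ[k] M) (u : H ⊗[k] M) : H →ₗ[k] H →ₗ[k] H ⊗[k] M :=
  ((TensorProduct.mapBilinear (RingHom.id k) H M H M).compl₁₂ (LinearMap.mul k H) actM).compr₂
    (LinearMap.applyₗ u)

theorem tensorAct_apply (actM : H →ₗ[k] M →ₗ[k] M) (u : H ⊗[k] M) (p q : H) :
    tensorAct actM u p q = TensorProduct.map (LinearMap.mulLeft k p) (actM q) u := rfl

theorem braiding_coact_tmul_one (hB : IsBialgebraInYD Q D) (f : M →ₗ[k] M) (A C E G g : H)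
    (u : H ⊗[k] M) :
    (TensorProduct.map (sandwichLift k A C E) (TensorProduct.map f (D.act G)))
        ((TensorProduct.tensorTensorTensorComm k H M H B)
          (u ⊗ₜ[k] D.coact (D.act g D.one)))
      = (Q.ε g * Q.ε G) • LinearMap.lTensor H ((TensorProduct.mk k M B).flip D.one)
          (TensorProduct.map (lrH k A (C * E)) f u) := by
  rw [hB.act_one, map_smul, hB.coact_one]
  induction u with
  | zero => simp
  | add x y hx hy => simp only [TensorProduct.add_tmul, map_add, hx, hy, smul_add]
  | tmul h m =>
    simp [sandwichLift, lrH, hB.act_one, mul_assoc, mul_smul]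

theorem act_mem_coinvariants (hB : IsBialgebraInYD Q D)
    {actM : H →ₗ[k] M →ₗ[k] M} {rcoact : M →ₗ[k] M ⊗[k] B}
    (hρ : ∀ h m, rcoact (actM h m)
      = ∑ j, (TensorProduct.map (actM (Q.Δ1 h j)) (D.act (Q.Δ2 h j))) (rcoact m))
    (h : H) {m : M} (hm : m ∈ coinvariants D rcoact) : actM h m ∈ coinvariants D rcoact := by
  rw [mem_coinvariants] at hm ⊢
  rw [hρ, hm]
  conv_rhs => rw [← Q.counit_right h]
  simp [hB.act_one, TensorProduct.sum_tmul, TensorProduct.smul_tmul]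

/-- On a coinvariant element the `H`-colinearity of `ρ_M` reads
`∑ m₍₋₁₎ ⊗ ρ_M(m₍₀₎) = ∑ m₍₋₁₎ ⊗ m₍₀₎ ⊗ 1_B`. -/
theorem lTensor_rcoact_coact_of_mem_coinvariants (hB : IsBialgebraInYD Q D)
    {actM : H →ₗ[k] M →ₗ[k] M} {coactM : M →ₗ[k] H ⊗[k] M}
    {ract : B →ₗ[k] M →ₗ[k] M} {rcoact : M →ₗ[k] M ⊗[k] B}
    (hM : IsRightBHopfModule Q D actM coactM ract rcoact)
    {m : M} (hm : m ∈ coinvariants D rcoact) :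
    LinearMap.lTensor H rcoact (coactM m)
      = LinearMap.lTensor H ((TensorProduct.mk k M B).flip D.one) (coactM m) := by
  rw [mem_coinvariants] at hm
  rw [hM.rcoact_Hcolinear, hm]
  have hY : ∀ i a, ∑ i2, Q.ε (Q.X2 i2) •
      TensorProduct.map (lrH k (Q.X1 i) (Q.x2 a * Q.X3 i2)) (actM (Q.X2 i))
        (coactM (actM (Q.x1 a * Q.X1 i2) m))
      = twistedCoact actM coactM (Q.X1 i) (Q.X2 i) m (Q.x1 a) (Q.x2 a) := fun i a => by
    simpa using sum_smul_bilin_eq_of_sum_tmul_eq_one Q.Φ_normal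
      ((twistedCoact actM coactM (Q.X1 i) (Q.X2 i) m).compl₁₂
        (LinearMap.mulLeft k (Q.x1 a)) (LinearMap.mulLeft k (Q.x2 a)))
  have hx : ∀ i, ∑ a, Q.ε (Q.x3 a) •
      twistedCoact actM coactM (Q.X1 i) (Q.X2 i) m (Q.x1 a) (Q.x2 a)
      = tensorAct actM (coactM m) (Q.X1 i) (Q.X2 i) := fun i => by
    rw [sum_smul_bilin_eq_of_sum_tmul_eq_one Q.Φ_inv_normal_right, twistedCoact_apply,
      tensorAct_apply, hM.yd.one_act]
    simp [lrH]
  have hX : ∑ i, Q.ε (Q.X3 i) • tensorAct actM (coactM m) (Q.X1 i) (Q.X2 i) = coactM m := by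
    rw [sum_smul_bilin_eq_of_sum_tmul_eq_one Q.Φ_normal_right, tensorAct_apply, hM.yd.one_act]
    simp
  conv_rhs => rw [← hX]
  simp only [← hx, ← hY, map_sum, map_smul, Finset.smul_sum, smul_smul, TensorProduct.map_tmul,
    LinearMap.comp_apply, braiding_coact_tmul_one hB, map_mul]
  refine Finset.sum_congr rfl fun i _ => Finset.sum_congr rfl fun a _ =>
    Finset.sum_congr rfl fun i2 _ => ?_
  congr 1
  ring

end Coinvariants

/-- Theorem 4.3 (i): for a quasi-Hopf algebra `H`, a Hopf algebra `B` in the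
braided category of left Yetter-Drinfeld modules over `H` and a right `B`-Hopf
module `M` in this category, the coinvariants
`M^{co B} = {m ∈ M | ρ_M(m) = m ⊗ 1_B}` form a Yetter-Drinfeld submodule of `M`:
they are stable under the `H`-action and the `H`-coaction maps `M^{co B}` into
`H ⊗ M^{co B}`. -/
theorem coinvariants_isYDSubmodule {k H : Type} [Field k] [Ring H] [Algebra k H]
    (Q : QuasiHopf k H) {B : Type} [AddCommGroup B] [Module k B]
    (D : BialgData Q.toQuasiBialgebra B) (Sb : B →ₗ[k] B)
    (hB : IsBraidedHopf Q.toQuasiBialgebra D Sb)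
    {M : Type} [AddCommGroup M] [Module k M]
    (actM : H →ₗ[k] M →ₗ[k] M) (coactM : M →ₗ[k] H ⊗[k] M)
    (ract : B →ₗ[k] M →ₗ[k] M) (rcoact : M →ₗ[k] M ⊗[k] B)
    (hM : IsRightBHopfModule Q.toQuasiBialgebra D actM coactM ract rcoact) :
    (∀ (h : H), ∀ m ∈ coinvariants D rcoact, actM h m ∈ coinvariants D rcoact) ∧
    (∀ m ∈ coinvariants D rcoact,
      coactM m ∈ LinearMap.range
        (LinearMap.lTensor H (coinvariants D rcoact).subtype)) := by
  refine ⟨fun h m hm => act_mem_coinvariants hB.bialg hM.rcoact_Hlinear h hm, fun m hm => ?_⟩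
  have hexact := Module.Flat.lTensor_exact H
    (LinearMap.exact_subtype_ker_map (rcoact - (TensorProduct.mk k M B).flip D.one))
  refine (hexact _).1 ?_
  rw [LinearMap.lTensor_sub, LinearMap.sub_apply, sub_eq_zero]
  exact lTensor_rcoact_coact_of_mem_coinvariants hB.bialg hM hm
end
end

section
/- Let H be a quasi-Hopf algebra over a field k, B a Hopf algebra in the braided category of left Yetter–Drinfeld modules over H, and M a right B-Hopf module in this category. Define P:M→M by P(m) = ∑ m_⟨0⟩ ← S̲(m_⟨1⟩). Then P(m) ∈ M^coB = {m∈M : ρ_M(m)=m⊗1_B} for every m∈M. -/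
open scoped TensorProduct

noncomputable section

namespace QuasiHopfModule

section Categorical

open CategoryTheory MonoidalCategory

variable {C : Type*} [Category* C] [MonoidalCategory C] {M B : C}

/-- The exchange of the two middle factors of `(M ⊗ B) ⊗ (B ⊗ B)` by `c`. -/
def middleSwap (c : B ⊗ B ⟶ B ⊗ B) (M : C) : (M ⊗ B) ⊗ (B ⊗ B) ⟶ (M ⊗ B) ⊗ (B ⊗ B) :=
  (α_ M B (B ⊗ B)).hom ≫ M ◁ ((α_ B B B).inv ≫ c ▷ B ≫ (α_ B B B).hom) ≫
    (α_ M B (B ⊗ B)).inv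

lemma whiskerLeft_mul_comp {mul : B ⊗ B ⟶ B} {ract : M ⊗ B ⟶ M}
    (ract_assoc : ract ▷ B ≫ ract = (α_ M B B).hom ≫ M ◁ mul ≫ ract) :
    M ◁ mul ≫ ract = (α_ M B B).inv ≫ ract ▷ B ≫ ract := by
  rw [ract_assoc, Iso.inv_hom_id_assoc]

lemma free_action_assoc {mul : B ⊗ B ⟶ B} {comul : B ⟶ B ⊗ B} {ract : M ⊗ B ⟶ M}
    {c : B ⊗ B ⟶ B ⊗ B}
    (ract_assoc : ract ▷ B ≫ ract = (α_ M B B).hom ≫ M ◁ mul ≫ ract)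
    (comul_mul : mul ≫ comul = (comul ⊗ₘ comul) ≫ middleSwap c B ≫ (mul ⊗ₘ mul)) :
    (M ◁ comul ≫ (α_ M B B).inv ≫ ract ▷ B) ▷ B ≫
        (M ⊗ B) ◁ comul ≫ middleSwap c M ≫ (ract ⊗ₘ mul)
      = (α_ M B B).hom ≫ M ◁ mul ≫ M ◁ comul ≫ (α_ M B B).inv ≫ ract ▷ B := by
  have hr : M ◁ (mul ⊗ₘ mul) ≫ (α_ M B B).inv ≫ ract ▷ B
      = (α_ M (B ⊗ B) (B ⊗ B)).inv ≫ (M ◁ mul ≫ ract) ▷ (B ⊗ B) ≫ M ◁ mul := by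
    rw [MonoidalCategory.tensorHom_def, whiskerLeft_comp, Category.assoc,
      associator_inv_naturality_right_assoc, whisker_exchange]
    simp
  have hl : (ract ▷ B) ▷ B ≫ (M ⊗ B) ◁ comul ≫ middleSwap c M ≫ (ract ⊗ₘ mul)
      = ((M ⊗ B) ⊗ B) ◁ comul ≫ (α_ (M ⊗ B) B (B ⊗ B)).hom ≫
        (M ⊗ B) ◁ ((α_ B B B).inv ≫ c ▷ B ≫ (α_ B B B).hom) ≫
        (α_ (M ⊗ B) B (B ⊗ B)).inv ≫ (ract ▷ B ≫ ract) ▷ (B ⊗ B) ≫ M ◁ mul := by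
    rw [← whisker_exchange_assoc]
    simp only [middleSwap, MonoidalCategory.tensorHom_def, comp_whiskerRight, Category.assoc]
    rw [associator_naturality_left_assoc, ← whisker_exchange_assoc,
      associator_inv_naturality_left_assoc]
  rw [comp_whiskerRight, comp_whiskerRight, Category.assoc, Category.assoc, hl,
    ← whiskerLeft_comp_assoc M mul, comul_mul, whiskerLeft_comp M (comul ⊗ₘ comul),
    whiskerLeft_comp M (middleSwap c B), Category.assoc, Category.assoc, hr,
    whiskerLeft_mul_comp ract_assoc]
  simp only [MonoidalCategory.tensorHom_def, middleSwap]
  monoidal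

/-- For a Hopf module `M` over a bialgebra `B` with antipode `S` in a monoidal category, where
the compatibility conditions use an arbitrary `c : B ⊗ B ⟶ B ⊗ B` in place of a braiding, the map
`P = ρ ≫ M ◁ S ≫ ract` takes values in the coinvariants. -/
theorem proj_comp_coaction {mul : B ⊗ B ⟶ B} {comul : B ⟶ B ⊗ B} {ract : M ⊗ B ⟶ M}
    {c : B ⊗ B ⟶ B ⊗ B} {one : 𝟙_ C ⟶ B} {counit : B ⟶ 𝟙_ C} {S : B ⟶ B} {ρ : M ⟶ M ⊗ B}
    (ract_assoc : ract ▷ B ≫ ract = (α_ M B B).hom ≫ M ◁ mul ≫ ract)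
    (ract_one : M ◁ one ≫ ract = (ρ_ M).hom)
    (comul_mul : mul ≫ comul = (comul ⊗ₘ comul) ≫ middleSwap c B ≫ (mul ⊗ₘ mul))
    (comul_one : one ≫ comul = (λ_ (𝟙_ C)).inv ≫ (one ⊗ₘ one))
    (antipode_left : comul ≫ S ▷ B ≫ mul = counit ≫ one)
    (antipode_right : comul ≫ B ◁ S ≫ mul = counit ≫ one)
    (coassoc : ρ ≫ ρ ▷ B ≫ (α_ M B B).hom = ρ ≫ M ◁ comul)
    (coaction_counit : ρ ≫ M ◁ counit = (ρ_ M).inv)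
    (ract_coaction : ract ≫ ρ
      = ρ ▷ B ≫ (M ⊗ B) ◁ comul ≫ middleSwap c M ≫ (ract ⊗ₘ mul)) :
    (ρ ≫ M ◁ S ≫ ract) ≫ ρ = (ρ ≫ M ◁ S ≫ ract) ≫ (ρ_ M).inv ≫ M ◁ one := by
  set P := ρ ≫ M ◁ S ≫ ract with hP
  have coassoc' : ρ ≫ M ◁ comul ≫ (α_ M B B).inv = ρ ≫ ρ ▷ B := by
    rw [← Category.assoc, ← coassoc]; simp
  have hrec : ρ ≫ P ▷ B ≫ ract = 𝟙 M := by
    calc ρ ≫ P ▷ B ≫ ract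
        = (ρ ≫ ρ ▷ B) ≫ (M ◁ S) ▷ B ≫ ract ▷ B ≫ ract := by simp [hP]
      _ = ρ ≫ M ◁ (comul ≫ S ▷ B ≫ mul) ≫ ract := by
          rw [← coassoc', ract_assoc]; simp
      _ = 𝟙 M := by
          rw [antipode_left, whiskerLeft_comp, Category.assoc, ract_one,
            reassoc_of% coaction_counit, Iso.inv_hom_id]
  have hfree : ρ ≫ P ▷ B ≫ M ◁ comul ≫ (α_ M B B).inv ≫ ract ▷ B = ρ := by
    calc ρ ≫ P ▷ B ≫ M ◁ comul ≫ (α_ M B B).inv ≫ ract ▷ B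
        = (ρ ≫ M ◁ comul ≫ (α_ M B B).inv) ≫ P ▷ B ▷ B ≫ ract ▷ B := by
          simp only [← whisker_exchange_assoc, Category.assoc,
            associator_inv_naturality_left_assoc]
      _ = ρ ≫ (ρ ≫ P ▷ B ≫ ract) ▷ B := by
          rw [coassoc']; simp
      _ = ρ := by rw [hrec]; simp
  have hone : M ◁ one ≫ M ◁ comul ≫ (α_ M B B).inv ≫ ract ▷ B = M ◁ one := by
    rw [← whiskerLeft_comp_assoc, comul_one]
    calc _ = (ρ_ M).inv ▷ 𝟙_ C ≫ (M ◁ one ≫ ract) ▷ 𝟙_ C ≫ M ◁ one := by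
          rw [comp_whiskerRight, Category.assoc, ← whisker_exchange]
          simp only [MonoidalCategory.tensorHom_def]
          monoidal
      _ = M ◁ one := by rw [ract_one]; simp
  calc P ≫ ρ
      = ρ ≫ M ◁ S ≫ ρ ▷ B ≫ (M ⊗ B) ◁ comul ≫ middleSwap c M ≫ (ract ⊗ₘ mul) := by
        rw [hP, Category.assoc, Category.assoc, ract_coaction]
    _ = ρ ≫ (ρ ≫ P ▷ B ≫ M ◁ comul ≫ (α_ M B B).inv ≫ ract ▷ B) ▷ B ≫ (M ⊗ B) ◁ S ≫
          (M ⊗ B) ◁ comul ≫ middleSwap c M ≫ (ract ⊗ₘ mul) := by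
        rw [hfree, whisker_exchange_assoc]
    _ = ρ ≫ (ρ ≫ P ▷ B) ▷ B ≫ (M ⊗ B) ◁ S ≫
          ((M ◁ comul ≫ (α_ M B B).inv ≫ ract ▷ B) ▷ B ≫
          (M ⊗ B) ◁ comul ≫ middleSwap c M ≫ (ract ⊗ₘ mul)) := by
        rw [whisker_exchange_assoc, ← comp_whiskerRight_assoc]
        simp only [Category.assoc]
    _ = (ρ ≫ ρ ▷ B ≫ (α_ M B B).hom) ≫ P ▷ (B ⊗ B) ≫ M ◁ (B ◁ S ≫ mul) ≫
          M ◁ comul ≫ (α_ M B B).inv ≫ ract ▷ B := by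
        rw [free_action_assoc ract_assoc comul_mul]
        simp
    _ = ρ ≫ P ▷ B ≫ M ◁ (comul ≫ B ◁ S ≫ mul) ≫
          M ◁ comul ≫ (α_ M B B).inv ≫ ract ▷ B := by
        rw [coassoc, whiskerLeft_comp _ comul, Category.assoc, Category.assoc,
          whisker_exchange_assoc]
    _ = (ρ ≫ M ◁ counit) ≫ P ▷ 𝟙_ C ≫ M ◁ one := by
        rw [antipode_right, whiskerLeft_comp, Category.assoc, hone, ← whisker_exchange_assoc,
          Category.assoc]
    _ = P ≫ (ρ_ M).inv ≫ M ◁ one := by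
        rw [coaction_counit, rightUnitor_inv_naturality_assoc]

end Categorical

section Representations

variable {k : Type} [Field k]

/-- The pairing `a ⊗ c ↦ (v ⊗ w ↦ f a v ⊗ g c w)`. -/
def tensorAct {A C V W : Type} [AddCommGroup A] [Module k A] [AddCommGroup C] [Module k C]
    [AddCommGroup V] [Module k V] [AddCommGroup W] [Module k W]
    (f : A →ₗ[k] V →ₗ[k] V) (g : C →ₗ[k] W →ₗ[k] W) :
    A ⊗[k] C →ₗ[k] V ⊗[k] W →ₗ[k] V ⊗[k] W :=
  TensorProduct.homTensorHomMap (RingHom.id k) V W V W ∘ₗ TensorProduct.map f g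

@[simp]
lemma tensorAct_tmul {A C V W : Type} [AddCommGroup A] [Module k A] [AddCommGroup C] [Module k C]
    [AddCommGroup V] [Module k V] [AddCommGroup W] [Module k W]
    (f : A →ₗ[k] V →ₗ[k] V) (g : C →ₗ[k] W →ₗ[k] W) (a : A) (c : C) :
    tensorAct f g (a ⊗ₜ c) = TensorProduct.map (f a) (g c) := by
  simp [tensorAct]

lemma tensorAct_mul {A C V W : Type} [Ring A] [Algebra k A] [Ring C] [Algebra k C]
    [AddCommGroup V] [Module k V] [AddCommGroup W] [Module k W]
    {f : A →ₗ[k] V →ₗ[k] V} {g : C →ₗ[k] W →ₗ[k] W}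
    (hf : ∀ a b, f (a * b) = f a ∘ₗ f b) (hg : ∀ a b, g (a * b) = g a ∘ₗ g b)
    (s t : A ⊗[k] C) : tensorAct f g (s * t) = tensorAct f g s ∘ₗ tensorAct f g t := by
  induction s with
  | zero => simp
  | add s s' h h' => simp [add_mul, h, h', LinearMap.add_comp]
  | tmul a c =>
    induction t with
    | zero => simp
    | add t t' h h' => simp [mul_add, h, h', LinearMap.comp_add]
    | tmul b d => simp [hf, hg, TensorProduct.map_comp]

lemma tensorAct_one {A C V W : Type} [Ring A] [Algebra k A] [Ring C] [Algebra k C]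
    [AddCommGroup V] [Module k V] [AddCommGroup W] [Module k W]
    {f : A →ₗ[k] V →ₗ[k] V} {g : C →ₗ[k] W →ₗ[k] W}
    (hf : f 1 = LinearMap.id) (hg : g 1 = LinearMap.id) :
    tensorAct f g 1 = LinearMap.id := by
  simp [Algebra.TensorProduct.one_def, hf, hg]

variable {H : Type} [Ring H] [Algebra k H] (Q : QuasiBialgebra k H)

variable {U V W Z : Type} [AddCommGroup U] [Module k U] [AddCommGroup V] [Module k V]
  [AddCommGroup W] [Module k W] [AddCommGroup Z] [Module k Z]
  (e : H →ₗ[k] U →ₗ[k] U) (f : H →ₗ[k] V →ₗ[k] V) (g : H →ₗ[k] W →ₗ[k] W)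
  (l : H →ₗ[k] Z →ₗ[k] Z)

/-- The diagonal action of `H` on a tensor product, through `Δ`. -/
def diagAct : H →ₗ[k] V ⊗[k] W →ₗ[k] V ⊗[k] W :=
  tensorAct f g ∘ₗ Q.Δmap.toLinearMap

lemma diagAct_apply (h : H) :
    diagAct Q f g h = ∑ j, TensorProduct.map (f (Q.Δ1 h j)) (g (Q.Δ2 h j)) := by
  simp [diagAct, Q.Δ_eq h]

@[simp]
lemma diagAct_tmul (h : H) (v : V) (w : W) :
    diagAct Q f g h (v ⊗ₜ w) = ∑ j, f (Q.Δ1 h j) v ⊗ₜ[k] g (Q.Δ2 h j) w := by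
  simp [diagAct_apply]

/-- The reassociator `Φ`. -/
def reassociator : H ⊗[k] (H ⊗[k] H) :=
  ∑ i, Q.X1 i ⊗ₜ[k] (Q.X2 i ⊗ₜ[k] Q.X3 i)

/-- The inverse reassociator `Φ⁻¹`. -/
def reassociatorInv : H ⊗[k] (H ⊗[k] H) :=
  ∑ a, Q.x1 a ⊗ₜ[k] (Q.x2 a ⊗ₜ[k] Q.x3 a)

/-- Reassociation by the action of `Φ`. -/
def assocMap : (U ⊗[k] V) ⊗[k] W →ₗ[k] U ⊗[k] (V ⊗[k] W) :=
  tensorAct e (tensorAct f g) (reassociator Q) ∘ₗ (TensorProduct.assoc k U V W).toLinearMap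

/-- Reassociation by the action of `Φ⁻¹`. -/
def assocInvMap : U ⊗[k] (V ⊗[k] W) →ₗ[k] (U ⊗[k] V) ⊗[k] W :=
  (TensorProduct.assoc k U V W).symm.toLinearMap ∘ₗ
    tensorAct e (tensorAct f g) (reassociatorInv Q)

@[simp]
lemma assocMap_tmul (u : U) (v : V) (w : W) :
    assocMap Q e f g ((u ⊗ₜ v) ⊗ₜ w)
      = ∑ i, e (Q.X1 i) u ⊗ₜ[k] (f (Q.X2 i) v ⊗ₜ[k] g (Q.X3 i) w) := by
  simp [assocMap, reassociator]

@[simp]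
lemma assocInvMap_tmul (u : U) (v : V) (w : W) :
    assocInvMap Q e f g (u ⊗ₜ (v ⊗ₜ w))
      = ∑ a, (e (Q.x1 a) u ⊗ₜ[k] f (Q.x2 a) v) ⊗ₜ[k] g (Q.x3 a) w := by
  simp [assocInvMap, reassociatorInv]

section Multiplicative

variable {e f g l}

lemma diagAct_mul
    (hf : ∀ a b, f (a * b) = f a ∘ₗ f b) (hg : ∀ a b, g (a * b) = g a ∘ₗ g b)
    (a b : H) : diagAct Q f g (a * b) = diagAct Q f g a ∘ₗ diagAct Q f g b := by
  simpa [diagAct] using tensorAct_mul hf hg (Q.Δmap a) (Q.Δmap b)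

lemma diagAct_one
    (hf1 : f 1 = LinearMap.id) (hg1 : g 1 = LinearMap.id) :
    diagAct Q f g 1 = LinearMap.id := by
  simpa [diagAct] using tensorAct_one hf1 hg1

lemma assocMap_comp_assocInvMap
    (he : ∀ a b, e (a * b) = e a ∘ₗ e b) (hf : ∀ a b, f (a * b) = f a ∘ₗ f b)
    (hg : ∀ a b, g (a * b) = g a ∘ₗ g b) (he1 : e 1 = LinearMap.id) (hf1 : f 1 = LinearMap.id)
    (hg1 : g 1 = LinearMap.id) :
    assocMap Q e f g ∘ₗ assocInvMap Q e f g = LinearMap.id := by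
  have h := tensorAct_mul he (tensorAct_mul hf hg) (reassociator Q) (reassociatorInv Q)
  rw [reassociator, reassociatorInv, Q.Φ_right_inv, tensorAct_one he1 (tensorAct_one hf1 hg1)] at h
  refine LinearMap.ext fun t => ?_
  simpa [assocMap, assocInvMap, reassociator, reassociatorInv] using (LinearMap.congr_fun h t).symm

lemma assocInvMap_comp_assocMap
    (he : ∀ a b, e (a * b) = e a ∘ₗ e b) (hf : ∀ a b, f (a * b) = f a ∘ₗ f b)
    (hg : ∀ a b, g (a * b) = g a ∘ₗ g b) (he1 : e 1 = LinearMap.id) (hf1 : f 1 = LinearMap.id)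
    (hg1 : g 1 = LinearMap.id) :
    assocInvMap Q e f g ∘ₗ assocMap Q e f g = LinearMap.id := by
  have h := tensorAct_mul he (tensorAct_mul hf hg) (reassociatorInv Q) (reassociator Q)
  rw [reassociator, reassociatorInv, Q.Φ_left_inv, tensorAct_one he1 (tensorAct_one hf1 hg1)] at h
  refine LinearMap.ext fun t => (TensorProduct.assoc k U V W).injective ?_
  simpa [assocMap, assocInvMap, reassociator, reassociatorInv] using
    (LinearMap.congr_fun h (TensorProduct.assoc k U V W t)).symm

lemma assocMap_comp_diagAct
    (he : ∀ a b, e (a * b) = e a ∘ₗ e b) (hf : ∀ a b, f (a * b) = f a ∘ₗ f b)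
    (hg : ∀ a b, g (a * b) = g a ∘ₗ g b)
    (h : H) :
    assocMap Q e f g ∘ₗ diagAct Q (diagAct Q e f) g h
      = diagAct Q e (diagAct Q f g) h ∘ₗ assocMap Q e f g := by
  have key := congrArg (fun s => tensorAct e (tensorAct f g) (s * reassociator Q))
    (Q.quasi_coassoc h)
  simp only [mul_assoc] at key
  rw [reassociator, Q.Φ_left_inv, mul_one, tensorAct_mul he (tensorAct_mul hf hg),
    tensorAct_mul he (tensorAct_mul hf hg)] at key
  have hleft : (TensorProduct.assoc k U V W).toLinearMap ∘ₗ diagAct Q (diagAct Q e f) g h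
      = tensorAct e (tensorAct f g)
          (∑ j, ∑ j', Q.Δ1 (Q.Δ1 h j) j' ⊗ₜ[k] (Q.Δ2 (Q.Δ1 h j) j' ⊗ₜ[k] Q.Δ2 h j))
        ∘ₗ (TensorProduct.assoc k U V W).toLinearMap :=
    TensorProduct.ext_threefold fun u v w => by simp [TensorProduct.sum_tmul]
  have hright : diagAct Q e (diagAct Q f g) h = tensorAct e (tensorAct f g)
      (∑ j, ∑ j', Q.Δ1 h j ⊗ₜ[k] (Q.Δ1 (Q.Δ2 h j) j' ⊗ₜ[k] Q.Δ2 (Q.Δ2 h j) j')) := by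
    ext u v w
    simp [TensorProduct.tmul_sum]
  rw [assocMap, reassociator, LinearMap.comp_assoc, hleft, ← LinearMap.comp_assoc, ← key, hright,
    LinearMap.comp_assoc]

lemma assocMap_pentagon
    (he : ∀ a b, e (a * b) = e a ∘ₗ e b) (hf : ∀ a b, f (a * b) = f a ∘ₗ f b)
    (hg : ∀ a b, g (a * b) = g a ∘ₗ g b) (hl : ∀ a b, l (a * b) = l a ∘ₗ l b)
    (he1 : e 1 = LinearMap.id) (hl1 : l 1 = LinearMap.id) :
    (assocMap Q f g l).lTensor U ∘ₗ assocMap Q e (diagAct Q f g) l ∘ₗ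
        (assocMap Q e f g).rTensor Z
      = assocMap Q e f (diagAct Q g l) ∘ₗ assocMap Q (diagAct Q e f) g l := by
  have hgl := tensorAct_mul hg hl
  have hfgl := tensorAct_mul hf hgl
  have key := congrArg (tensorAct e (tensorAct f (tensorAct g l))) Q.cocycle
  rw [tensorAct_mul he hfgl, tensorAct_mul he hfgl, tensorAct_mul he hfgl] at key
  set E := tensorAct e (tensorAct f (tensorAct g l))
  let A := (TensorProduct.assoc k V W Z).toLinearMap.lTensor U ∘ₗ
    (TensorProduct.assoc k U (V ⊗[k] W) Z).toLinearMap
  let R := (TensorProduct.assoc k U V (W ⊗[k] Z)).toLinearMap ∘ₗ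
    (TensorProduct.assoc k (U ⊗[k] V) W Z).toLinearMap
  have h₁ : A ∘ₗ (assocMap Q e f g).rTensor Z
      = E (∑ i, Q.X1 i ⊗ₜ[k] (Q.X2 i ⊗ₜ[k] (Q.X3 i ⊗ₜ[k] (1 : H)))) ∘ₗ R :=
    TensorProduct.ext_fourfold fun u v w z => by
      simp [A, R, E, TensorProduct.sum_tmul, hl1]
  have h₂ : (TensorProduct.assoc k V W Z).toLinearMap.lTensor U ∘ₗ assocMap Q e (diagAct Q f g) l
      = E (∑ i, ∑ j, Q.X1 i ⊗ₜ[k] (Q.Δ1 (Q.X2 i) j ⊗ₜ[k] (Q.Δ2 (Q.X2 i) j ⊗ₜ[k] Q.X3 i))) ∘ₗ A := by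
    ext u v w z
    simp [A, E, TensorProduct.sum_tmul, TensorProduct.tmul_sum]
  have h₃ : (assocMap Q f g l).lTensor U
      = E (∑ i, (1 : H) ⊗ₜ[k] (Q.X1 i ⊗ₜ[k] (Q.X2 i ⊗ₜ[k] Q.X3 i))) ∘ₗ
        (TensorProduct.assoc k V W Z).toLinearMap.lTensor U := by
    ext u v w z
    simp [E, TensorProduct.tmul_sum, he1]
  have h₄ : (TensorProduct.assoc k U V (W ⊗[k] Z)).toLinearMap ∘ₗ assocMap Q (diagAct Q e f) g l
      = E (∑ i, ∑ j, Q.Δ1 (Q.X1 i) j ⊗ₜ[k] (Q.Δ2 (Q.X1 i) j ⊗ₜ[k] (Q.X2 i ⊗ₜ[k] Q.X3 i))) ∘ₗ R :=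
    TensorProduct.ext_fourfold fun u v w z => by
      simp [R, E, TensorProduct.sum_tmul]
  have h₅ : assocMap Q e f (diagAct Q g l)
      = E (∑ i, ∑ j, Q.X1 i ⊗ₜ[k] (Q.X2 i ⊗ₜ[k] (Q.Δ1 (Q.X3 i) j ⊗ₜ[k] Q.Δ2 (Q.X3 i) j))) ∘ₗ
        (TensorProduct.assoc k U V (W ⊗[k] Z)).toLinearMap := by
    ext u v w z
    simp [E, TensorProduct.tmul_sum]
  rw [h₃, LinearMap.comp_assoc, ← LinearMap.comp_assoc ((assocMap Q e f g).rTensor Z), h₂,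
    LinearMap.comp_assoc _ A, h₁, h₅, LinearMap.comp_assoc, h₄, ← LinearMap.comp_assoc,
    ← LinearMap.comp_assoc, key, LinearMap.comp_assoc]

end Multiplicative

/-- The trivial action, through `ε`. -/
def trivAct : H →ₗ[k] k →ₗ[k] k := LinearMap.mul k k ∘ₗ Q.ε.toLinearMap

@[simp]
lemma trivAct_apply (h : H) (c : k) : trivAct Q h c = Q.ε h * c := rfl

lemma lid_comp_diagAct (h : H) :
    (TensorProduct.lid k V).toLinearMap ∘ₗ diagAct Q (trivAct Q) f h
      = f h ∘ₗ (TensorProduct.lid k V).toLinearMap := by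
  ext v
  simpa using LinearMap.congr_fun (congrArg f (Q.counit_left h)) v

lemma rid_comp_diagAct (h : H) :
    (TensorProduct.rid k V).toLinearMap ∘ₗ diagAct Q f (trivAct Q) h
      = f h ∘ₗ (TensorProduct.rid k V).toLinearMap := by
  ext v
  simpa using LinearMap.congr_fun (congrArg f (Q.counit_right h)) v

lemma assocMap_triangle (he1 : e 1 = LinearMap.id) (hg1 : g 1 = LinearMap.id) :
    (TensorProduct.lid k W).toLinearMap.lTensor U ∘ₗ assocMap Q e (trivAct Q) g
      = (TensorProduct.rid k U).toLinearMap.rTensor W := by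
  refine TensorProduct.ext_threefold fun u c w => ?_
  have key := LinearMap.congr_fun (congrArg (tensorAct e g) Q.Φ_normal) (c • u ⊗ₜ w)
  rw [tensorAct_one he1 hg1] at key
  simpa [TensorProduct.smul_tmul', mul_smul, smul_comm c, TensorProduct.tmul_smul] using key

lemma map_comp_diagAct {V' W' : Type} [AddCommGroup V'] [Module k V'] [AddCommGroup W']
    [Module k W'] {f' : H →ₗ[k] V' →ₗ[k] V'} {g' : H →ₗ[k] W' →ₗ[k] W'} {s : V →ₗ[k] V'}
    {t : W →ₗ[k] W'} (hs : ∀ h v, s (f h v) = f' h (s v)) (ht : ∀ h w, t (g h w) = g' h (t w))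
    (h : H) :
    TensorProduct.map s t ∘ₗ diagAct Q f g h = diagAct Q f' g' h ∘ₗ TensorProduct.map s t := by
  ext v w
  simp [hs, ht]

end Representations

section Sums

variable {R I I' J L L' K : Type} [AddCommMonoid R] [Fintype I] [Fintype I'] [Fintype J]
  [Fintype L] [Fintype L'] [Fintype K]

lemma sum_comm_seven (F : I' → I → I → I' → J → J → K → R) :
    ∑ i, ∑ j, ∑ a2, ∑ κ, ∑ i2, ∑ a, ∑ j2, F a i i2 a2 j j2 κ
      = ∑ a, ∑ i, ∑ i2, ∑ a2, ∑ j, ∑ j2, ∑ κ, F a i i2 a2 j j2 κ := by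
  simp only [← Fintype.sum_prod_type']
  exact Fintype.sum_equiv
    { toFun := fun ⟨i, j, a2, κ, i2, a, j2⟩ => ⟨a, i, i2, a2, j, j2, κ⟩
      invFun := fun ⟨a, i, i2, a2, j, j2, κ⟩ => ⟨i, j, a2, κ, i2, a, j2⟩
      left_inv := fun _ => rfl
      right_inv := fun _ => rfl } _ _ fun _ => rfl

lemma sum_comm_eight (F : I' → I → I → I' → J → J → L → K → R) :
    ∑ a, ∑ i, ∑ i2, ∑ a2, ∑ j, ∑ j2, ∑ l, ∑ κ, F a i i2 a2 j j2 l κ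
      = ∑ l, ∑ a, ∑ i, ∑ i2, ∑ a2, ∑ j, ∑ j2, ∑ κ, F a i i2 a2 j j2 l κ := by
  simp only [← Fintype.sum_prod_type']
  exact Fintype.sum_equiv
    { toFun := fun ⟨a, i, i2, a2, j, j2, l, κ⟩ => ⟨l, a, i, i2, a2, j, j2, κ⟩
      invFun := fun ⟨l, a, i, i2, a2, j, j2, κ⟩ => ⟨a, i, i2, a2, j, j2, l, κ⟩
      left_inv := fun _ => rfl
      right_inv := fun _ => rfl } _ _ fun _ => rfl

lemma sum_comm_nine (F : I' → I → I → I' → J → J → L → L' → K → R) :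
    ∑ a, ∑ i, ∑ i2, ∑ a2, ∑ j, ∑ j2, ∑ l, ∑ l', ∑ κ, F a i i2 a2 j j2 l l' κ
      = ∑ l', ∑ l, ∑ a, ∑ i, ∑ i2, ∑ a2, ∑ j, ∑ j2, ∑ κ, F a i i2 a2 j j2 l l' κ := by
  simp only [← Fintype.sum_prod_type']
  exact Fintype.sum_equiv
    { toFun := fun ⟨a, i, i2, a2, j, j2, l, l', κ⟩ => ⟨l', l, a, i, i2, a2, j, j2, κ⟩
      invFun := fun ⟨l', l, a, i, i2, a2, j, j2, κ⟩ => ⟨a, i, i2, a2, j, j2, l, l', κ⟩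
      left_inv := fun _ => rfl
      right_inv := fun _ => rfl } _ _ fun _ => rfl

end Sums

section Swap

variable {k H : Type} [Field k] [Ring H] [Algebra k H] {Q : QuasiBialgebra k H}
  {B M : Type} [AddCommGroup B] [Module k B] [AddCommGroup M] [Module k M]

/-- The braiding `b ⊗ d ↦ ∑ b₍₋₁₎·d ⊗ b₍₀₎`. -/
def braidMap (D : BialgData Q B) : B ⊗[k] B →ₗ[k] B ⊗[k] B :=
  TensorProduct.map (TensorProduct.lift D.act) LinearMap.id ∘ₗ
    (TensorProduct.rightComm k H B B).toLinearMap ∘ₗ D.coact.rTensor B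

/-- The exchange of the two middle factors of `(M ⊗ B) ⊗ (B ⊗ B)` by the braiding. -/
def middleSwapMap (D : BialgData Q B) (actM : H →ₗ[k] M →ₗ[k] M) :
    (M ⊗[k] B) ⊗[k] (B ⊗[k] B) →ₗ[k] (M ⊗[k] B) ⊗[k] (B ⊗[k] B) :=
  assocInvMap Q actM D.act (diagAct Q D.act D.act) ∘ₗ
    (assocMap Q D.act D.act D.act ∘ₗ (braidMap D).rTensor B ∘ₗ
      assocInvMap Q D.act D.act D.act).lTensor M ∘ₗ
    assocMap Q actM D.act (diagAct Q D.act D.act)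

lemma braidMap_tmul {D : BialgData Q B} (hB : IsBialgebraInYD Q D) (b d : B) :
    braidMap D (b ⊗ₜ d) = ∑ κ, D.act (D.cm1 b κ) d ⊗ₜ[k] D.cm0 b κ := by
  simp [braidMap, hB.coact_eq, TensorProduct.sum_tmul]

lemma middleSwapMap_tmul {D : BialgData Q B} (hB : IsBialgebraInYD Q D)
    {actM : H →ₗ[k] M →ₗ[k] M} (hM : ∀ g h, actM (g * h) = actM g ∘ₗ actM h) (m : M) (b d e : B) :
    middleSwapMap D actM ((m ⊗ₜ b) ⊗ₜ (d ⊗ₜ e))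
      = ∑ a, ∑ i, ∑ i2, ∑ a2, ∑ j, ∑ j2, ∑ κ,
        (actM (Q.x1 a * Q.X1 i) m
          ⊗ₜ[k] D.act (Q.x2 a * Q.X1 i2 * D.cm1 (D.act (Q.x1 a2 * Q.X2 i) b) κ
              * Q.x2 a2 * Q.Δ1 (Q.X3 i) j) d)
        ⊗ₜ[k] (D.act (Q.Δ1 (Q.x3 a) j2 * Q.X2 i2) (D.cm0 (D.act (Q.x1 a2 * Q.X2 i) b) κ)
          ⊗ₜ[k] D.act (Q.Δ2 (Q.x3 a) j2 * Q.X3 i2 * Q.x3 a2 * Q.Δ2 (Q.X3 i) j) e) := by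
  simp only [middleSwapMap, LinearMap.comp_apply, assocMap_tmul, diagAct_tmul, map_sum,
    LinearMap.lTensor_tmul, LinearMap.rTensor_tmul, TensorProduct.tmul_sum,
    TensorProduct.sum_tmul, assocInvMap_tmul, braidMap_tmul hB, hM, hB.yd.mul_act]
  exact sum_comm_seven _

lemma map_middleSwapMap_tmul {D : BialgData Q B} (hB : IsBialgebraInYD Q D)
    {actM : H →ₗ[k] M →ₗ[k] M} (hM : ∀ g h, actM (g * h) = actM g ∘ₗ actM h)
    {N N' : Type} [AddCommGroup N] [Module k N] [AddCommGroup N'] [Module k N']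
    (φ : M ⊗[k] B →ₗ[k] N) (ψ : B ⊗[k] B →ₗ[k] N') (m : M) (b d e : B) :
    TensorProduct.map φ ψ (middleSwapMap D actM ((m ⊗ₜ b) ⊗ₜ (d ⊗ₜ e)))
      = ∑ a, ∑ i, ∑ i2, ∑ a2, ∑ j, ∑ j2, ∑ κ,
        φ (actM (Q.x1 a * Q.X1 i) m
          ⊗ₜ[k] D.act (Q.x2 a * Q.X1 i2 * D.cm1 (D.act (Q.x1 a2 * Q.X2 i) b) κ
              * Q.x2 a2 * Q.Δ1 (Q.X3 i) j) d)
        ⊗ₜ[k] ψ (D.act (Q.Δ1 (Q.x3 a) j2 * Q.X2 i2) (D.cm0 (D.act (Q.x1 a2 * Q.X2 i) b) κ)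
          ⊗ₜ[k] D.act (Q.Δ2 (Q.x3 a) j2 * Q.X3 i2 * Q.x3 a2 * Q.Δ2 (Q.X3 i) j) e) := by
  rw [middleSwapMap_tmul hB hM]
  simp only [map_sum, TensorProduct.map_tmul]

lemma braidMap_comp_diagAct {D : BialgData Q B} (hB : IsBialgebraInYD Q D) (h : H) :
    braidMap D ∘ₗ diagAct Q D.act D.act h = diagAct Q D.act D.act h ∘ₗ braidMap D := by
  ext b d
  have key := congrArg
    (TensorProduct.map (D.act.flip d) (LinearMap.id : B →ₗ[k] B)) (hB.yd.yd3 h b)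
  simp only [hB.coact_eq, map_sum, TensorProduct.map_tmul, LinearMap.rTensor_tmul,
    LinearMap.mulLeft_apply, LinearMap.mulRight_apply, LinearMap.flip_apply, LinearMap.id_apply,
    hB.yd.mul_act, LinearMap.comp_apply] at key
  simp only [TensorProduct.AlgebraTensorModule.curry_apply, TensorProduct.curry_apply,
    LinearMap.restrictScalars_self, LinearMap.comp_apply, diagAct_tmul, map_sum,
    braidMap_tmul hB]
  rw [← key, Finset.sum_comm]

lemma comul_comp_mul {D : BialgData Q B} (hB : IsBialgebraInYD Q D) :
    D.comul ∘ₗ TensorProduct.lift D.mul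
      = TensorProduct.map (TensorProduct.lift D.mul) (TensorProduct.lift D.mul) ∘ₗ
        middleSwapMap D D.act ∘ₗ TensorProduct.map D.comul D.comul := by
  refine TensorProduct.ext' fun b b' => ?_
  have key := hB.comul_mul b b'
  rw [sum_comm_nine] at key
  simp only [LinearMap.comp_apply, TensorProduct.lift.tmul, TensorProduct.map_tmul]
  rw [key, hB.comul_eq b, hB.comul_eq b']
  simp only [TensorProduct.sum_tmul, TensorProduct.tmul_sum, map_sum]
  refine Finset.sum_congr rfl fun l' _ => Finset.sum_congr rfl fun l _ => ?_
  refine Eq.trans ?_ (map_middleSwapMap_tmul hB hB.yd.mul_act _ _ _ _ _ _).symm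
  simp only [TensorProduct.lift.tmul]

lemma rcoact_comp_ract {D : BialgData Q B} (hB : IsBialgebraInYD Q D)
    {actM : H →ₗ[k] M →ₗ[k] M} {coactM : M →ₗ[k] H ⊗[k] M} {ract : B →ₗ[k] M →ₗ[k] M}
    {rcoact : M →ₗ[k] M ⊗[k] B} (hM : IsRightBHopfModule Q D actM coactM ract rcoact) :
    rcoact ∘ₗ TensorProduct.lift ract.flip
      = TensorProduct.map (TensorProduct.lift ract.flip) (TensorProduct.lift D.mul) ∘ₗ
        middleSwapMap D actM ∘ₗ TensorProduct.map rcoact D.comul := by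
  ext m b
  simp only [TensorProduct.AlgebraTensorModule.curry_apply, TensorProduct.curry_apply,
    LinearMap.restrictScalars_self, LinearMap.comp_apply, TensorProduct.lift.tmul,
    TensorProduct.map_tmul, LinearMap.flip_apply, hM.rcoact_ract]
  induction rcoact m with
  | zero => simp
  | add s t hs ht => simp only [map_add, TensorProduct.add_tmul, Finset.sum_add_distrib, hs, ht]
  | tmul x c =>
    let F := TensorProduct.map (TensorProduct.lift ract.flip) (TensorProduct.lift D.mul) ∘ₗ
      middleSwapMap D actM
    have key : F ((x ⊗ₜ c) ⊗ₜ D.comul b)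
        = ∑ l, F ((x ⊗ₜ c) ⊗ₜ (D.D1 b l ⊗ₜ D.D2 b l)) := by
      rw [hB.comul_eq b]
      simp only [TensorProduct.tmul_sum, map_sum]
    simp only [LinearMap.lTensor_tmul, LinearMap.comp_apply, hB.coact_eq, TensorProduct.tmul_sum,
      map_sum, TensorProduct.assoc_symm_tmul, TensorProduct.map_tmul]
    refine ((sum_comm_eight _).trans ?_).trans key.symm
    refine Finset.sum_congr rfl fun l _ => ?_
    refine Eq.trans ?_ (map_middleSwapMap_tmul hB hM.yd.mul_act _ _ _ _ _ _).symm
    simp only [TensorProduct.lift.tmul, LinearMap.flip_apply, LinearMap.comp_apply, lrH,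
      LinearMap.mulLeft_apply, LinearMap.mulRight_apply, mul_assoc]

end Swap

section RepCategory

variable {k H : Type} [Field k] [Ring H] [Algebra k H]

/-- A representation of the algebra underlying a quasi-bialgebra. -/
structure QRep (Q : QuasiBialgebra k H) where
  V : Type
  [addCommGroup : AddCommGroup V]
  [module : Module k V]
  act : H →ₗ[k] V →ₗ[k] V
  act_one : act 1 = LinearMap.id
  act_mul : ∀ g h, act (g * h) = act g ∘ₗ act h

attribute [instance] QRep.addCommGroup QRep.module

open CategoryTheory MonoidalCategory

namespace QRep

variable {Q : QuasiBialgebra k H}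

/-- An intertwiner of representations. -/
@[ext]
structure Hom (V W : QRep Q) where
  lin : V.V →ₗ[k] W.V
  comm : ∀ h v, lin (V.act h v) = W.act h (lin v)

instance : Category (QRep Q) where
  Hom := Hom
  id V := ⟨LinearMap.id, fun _ _ => rfl⟩
  comp f g := ⟨g.lin ∘ₗ f.lin, fun h v => by simp [f.comm, g.comm]⟩

@[ext]
lemma hom_ext {V W : QRep Q} {f g : V ⟶ W} (h : f.lin = g.lin) : f = g := Hom.ext h

@[simp] lemma id_lin (V : QRep Q) : Hom.lin (𝟙 V) = LinearMap.id := rfl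

@[simp] lemma comp_lin {U V W : QRep Q} (f : U ⟶ V) (g : V ⟶ W) :
    (f ≫ g).lin = g.lin ∘ₗ f.lin := rfl

/-- An isomorphism given by mutually inverse linear maps, the first of which is an
intertwiner. -/
def isoOfLinearMap {V W : QRep Q} (s : V.V →ₗ[k] W.V) (t : W.V →ₗ[k] V.V)
    (hs : ∀ h, s ∘ₗ V.act h = W.act h ∘ₗ s) (hst : s ∘ₗ t = LinearMap.id)
    (hts : t ∘ₗ s = LinearMap.id) : V ≅ W where
  hom := ⟨s, fun h => LinearMap.congr_fun (hs h)⟩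
  inv := ⟨t, fun h w => by
    have hw := LinearMap.congr_fun (hs h) (t w)
    have hw' := LinearMap.congr_fun hst w
    simp only [LinearMap.comp_apply, LinearMap.id_apply] at hw hw'
    rw [hw'] at hw
    rw [← hw]
    exact LinearMap.congr_fun hts (V.act h (t w))⟩
  hom_inv_id := hom_ext hts
  inv_hom_id := hom_ext hst

/-- The tensor product of representations, with action through `Δ`. -/
def tensor (V W : QRep Q) : QRep Q where
  V := V.V ⊗[k] W.V
  act := diagAct Q V.act W.act
  act_one := diagAct_one Q V.act_one W.act_one
  act_mul := diagAct_mul Q V.act_mul W.act_mul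

/-- The tensor product of intertwiners. -/
def tensorMap {V V' W W' : QRep Q} (s : V ⟶ V') (t : W ⟶ W') : V.tensor W ⟶ V'.tensor W' where
  lin := TensorProduct.map s.lin t.lin
  comm h := LinearMap.congr_fun (map_comp_diagAct Q V.act W.act s.comm t.comm h)

/-- The trivial representation, with action through `ε`. -/
def trivial (Q : QuasiBialgebra k H) : QRep Q where
  V := k
  act := trivAct Q
  act_one := by ext; simp
  act_mul g h := by ext; simp

/-- The associator, given by the action of `Φ`. -/
def associator (U V W : QRep Q) : (U.tensor V).tensor W ≅ U.tensor (V.tensor W) :=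
  isoOfLinearMap (assocMap Q U.act V.act W.act) (assocInvMap Q U.act V.act W.act)
    (assocMap_comp_diagAct Q U.act_mul V.act_mul W.act_mul)
    (assocMap_comp_assocInvMap Q U.act_mul V.act_mul W.act_mul U.act_one V.act_one W.act_one)
    (assocInvMap_comp_assocMap Q U.act_mul V.act_mul W.act_mul U.act_one V.act_one W.act_one)

/-- The left unitor. -/
def leftUnitor (V : QRep Q) : (trivial Q).tensor V ≅ V :=
  isoOfLinearMap (TensorProduct.lid k V.V).toLinearMap (TensorProduct.lid k V.V).symm.toLinearMap
    (lid_comp_diagAct Q V.act) (LinearEquiv.comp_symm _) (LinearEquiv.symm_comp _)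

/-- The right unitor. -/
def rightUnitor (V : QRep Q) : V.tensor (trivial Q) ≅ V :=
  isoOfLinearMap (TensorProduct.rid k V.V).toLinearMap (TensorProduct.rid k V.V).symm.toLinearMap
    (rid_comp_diagAct Q V.act) (LinearEquiv.comp_symm _) (LinearEquiv.symm_comp _)

lemma assocMap_natural {U V W U' V' W' : QRep Q} (r : U ⟶ U') (s : V ⟶ V') (t : W ⟶ W') :
    assocMap Q U'.act V'.act W'.act ∘ₗ TensorProduct.map (TensorProduct.map r.lin s.lin) t.lin
      = TensorProduct.map r.lin (TensorProduct.map s.lin t.lin) ∘ₗ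
        assocMap Q U.act V.act W.act :=
  TensorProduct.ext_threefold fun u v w => by simp [r.comm, s.comm, t.comm]

instance : MonoidalCategoryStruct (QRep Q) where
  tensorObj := tensor
  whiskerLeft V _ _ t := tensorMap (𝟙 V) t
  whiskerRight s W := tensorMap s (𝟙 W)
  tensorHom := tensorMap
  tensorUnit := trivial Q
  associator := associator
  leftUnitor := leftUnitor
  rightUnitor := rightUnitor

instance : MonoidalCategory (QRep Q) :=
  MonoidalCategory.ofTensorHom
    (id_tensorHom_id := fun _ _ => hom_ext TensorProduct.map_id)
    (id_tensorHom := fun _ _ _ _ => rfl)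
    (tensorHom_id := fun _ _ => rfl)
    (tensorHom_comp_tensorHom := fun f₁ f₂ g₁ g₂ =>
      hom_ext (TensorProduct.map_comp g₁.lin g₂.lin f₁.lin f₂.lin).symm)
    (associator_naturality := fun r s t => hom_ext (assocMap_natural r s t))
    (leftUnitor_naturality := fun {V W} s => hom_ext (by
      change (TensorProduct.lid k W.V).toLinearMap ∘ₗ TensorProduct.map LinearMap.id s.lin
        = s.lin ∘ₗ (TensorProduct.lid k V.V).toLinearMap
      ext v
      simp))
    (rightUnitor_naturality := fun {V W} s => hom_ext (by
      change (TensorProduct.rid k W.V).toLinearMap ∘ₗ TensorProduct.map s.lin LinearMap.id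
        = s.lin ∘ₗ (TensorProduct.rid k V.V).toLinearMap
      ext v
      simp))
    (pentagon := fun U V W Z => hom_ext (assocMap_pentagon Q U.act_mul V.act_mul W.act_mul
      Z.act_mul U.act_one Z.act_one))
    (triangle := fun U W => hom_ext (assocMap_triangle Q U.act W.act U.act_one W.act_one))

end QRep

end RepCategory

section HopfModule

variable {k H : Type} [Field k] [Ring H] [Algebra k H] {Q : QuasiBialgebra k H}
  {B M : Type} [AddCommGroup B] [Module k B] [AddCommGroup M] [Module k M]

open CategoryTheory MonoidalCategory

namespace QRep

/-- The representation underlying a left Yetter-Drinfeld module. -/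
abbrev ofYD {act : H →ₗ[k] M →ₗ[k] M} {coact : M →ₗ[k] H ⊗[k] M} (hM : IsLeftYD Q act coact) :
    QRep Q where
  V := M
  act := act
  act_one := hM.one_act
  act_mul := hM.mul_act

end QRep

open QRep

section Algebra

variable {D : BialgData Q B} (hB : IsBialgebraInYD Q D)

/-- The multiplication as an intertwiner. -/
def mulHom : ofYD hB.yd ⊗ ofYD hB.yd ⟶ ofYD hB.yd where
  lin := TensorProduct.lift D.mul
  comm h := LinearMap.congr_fun (TensorProduct.ext' (g := TensorProduct.lift D.mul ∘ₗ
    diagAct Q D.act D.act h) (h := D.act h ∘ₗ TensorProduct.lift D.mul)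
    fun a b => by simp [hB.act_mul])

/-- The comultiplication as an intertwiner. -/
def comulHom : ofYD hB.yd ⟶ ofYD hB.yd ⊗ ofYD hB.yd where
  lin := D.comul
  comm h b := by
    refine (hB.comul_act h b).trans ?_
    change _ = diagAct Q D.act D.act h (D.comul b)
    rw [diagAct_apply, LinearMap.sum_apply]

/-- The unit as an intertwiner. -/
def oneHom : 𝟙_ (QRep Q) ⟶ ofYD hB.yd where
  lin := LinearMap.toSpanSingleton k B D.one
  comm h (c : k) := by
    change (Q.ε h * c) • D.one = D.act h (c • D.one)
    rw [map_smul, hB.act_one, smul_smul, mul_comm]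

/-- The counit as an intertwiner. -/
def counitHom : ofYD hB.yd ⟶ 𝟙_ (QRep Q) where
  lin := D.counit
  comm := hB.counit_act

/-- The braiding as an intertwiner. -/
def braidHom : ofYD hB.yd ⊗ ofYD hB.yd ⟶ ofYD hB.yd ⊗ ofYD hB.yd where
  lin := braidMap D
  comm h := LinearMap.congr_fun (braidMap_comp_diagAct hB h)

lemma mulHom_comp_comulHom :
    mulHom hB ≫ comulHom hB = (comulHom hB ⊗ₘ comulHom hB) ≫
      middleSwap (braidHom hB) (ofYD hB.yd) ≫ (mulHom hB ⊗ₘ mulHom hB) :=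
  hom_ext (comul_comp_mul hB)

lemma oneHom_comp_comulHom :
    oneHom hB ≫ comulHom hB = (λ_ (𝟙_ (QRep Q))).inv ≫ (oneHom hB ⊗ₘ oneHom hB) := by
  refine hom_ext (LinearMap.ext fun (c : k) => ?_)
  change D.comul (c • D.one) = TensorProduct.map (LinearMap.toSpanSingleton k B D.one)
    (LinearMap.toSpanSingleton k B D.one) ((TensorProduct.lid k k).symm c)
  simp [hB.comul_one, TensorProduct.tmul_smul]

end Algebra

section Antipode

variable {D : BialgData Q B} {Sb : B →ₗ[k] B} (hB : IsBraidedHopf Q D Sb)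

/-- The antipode as an intertwiner. -/
def antipodeHom : ofYD hB.bialg.yd ⟶ ofYD hB.bialg.yd where
  lin := Sb
  comm := hB.antipode_Hlinear

lemma antipodeHom_left :
    comulHom hB.bialg ≫ antipodeHom hB ▷ _ ≫ mulHom hB.bialg
      = counitHom hB.bialg ≫ oneHom hB.bialg := by
  refine hom_ext (LinearMap.ext fun b => ?_)
  change TensorProduct.lift D.mul (TensorProduct.map Sb LinearMap.id (D.comul b))
    = D.counit b • D.one
  simp [hB.bialg.comul_eq, ← hB.antipode_left]

lemma antipodeHom_right :
    comulHom hB.bialg ≫ _ ◁ antipodeHom hB ≫ mulHom hB.bialg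
      = counitHom hB.bialg ≫ oneHom hB.bialg := by
  refine hom_ext (LinearMap.ext fun b => ?_)
  change TensorProduct.lift D.mul (TensorProduct.map LinearMap.id Sb (D.comul b))
    = D.counit b • D.one
  simp [hB.bialg.comul_eq, ← hB.antipode_right]

end Antipode

section Module

variable {D : BialgData Q B} {actM : H →ₗ[k] M →ₗ[k] M} {coactM : M →ₗ[k] H ⊗[k] M}
  {ract : B →ₗ[k] M →ₗ[k] M} {rcoact : M →ₗ[k] M ⊗[k] B} (hB : IsBialgebraInYD Q D)
  (hM : IsRightBHopfModule Q D actM coactM ract rcoact)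

/-- The right `B`-action as an intertwiner. -/
def ractHom : ofYD hM.yd ⊗ ofYD hB.yd ⟶ ofYD hM.yd where
  lin := TensorProduct.lift ract.flip
  comm h := LinearMap.congr_fun (TensorProduct.ext' (g := TensorProduct.lift ract.flip ∘ₗ
    diagAct Q actM D.act h) (h := actM h ∘ₗ TensorProduct.lift ract.flip)
    fun m b => by simp [hM.ract_Hlinear])

/-- The right `B`-coaction as an intertwiner. -/
def rcoactHom : ofYD hM.yd ⟶ ofYD hM.yd ⊗ ofYD hB.yd where
  lin := rcoact
  comm h m := by
    refine (hM.rcoact_Hlinear h m).trans ?_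
    change _ = diagAct Q actM D.act h (rcoact m)
    rw [diagAct_apply, LinearMap.sum_apply]

lemma ractHom_assoc :
    ractHom hB hM ▷ ofYD hB.yd ≫ ractHom hB hM
      = (α_ _ _ _).hom ≫ ofYD hM.yd ◁ mulHom hB ≫ ractHom hB hM := by
  refine hom_ext (TensorProduct.ext_threefold
    (g := TensorProduct.lift ract.flip ∘ₗ
      TensorProduct.map (TensorProduct.lift ract.flip) LinearMap.id)
    (h := (TensorProduct.lift ract.flip ∘ₗ
      TensorProduct.map LinearMap.id (TensorProduct.lift D.mul)) ∘ₗ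
      assocMap Q actM D.act D.act) fun m b b' => ?_)
  simp [hM.ract_assoc]

lemma ractHom_one :
    ofYD hM.yd ◁ oneHom hB ≫ ractHom hB hM = (ρ_ (ofYD hM.yd)).hom := by
  refine hom_ext (TensorProduct.ext'
    (g := TensorProduct.lift ract.flip ∘ₗ
      TensorProduct.map LinearMap.id (LinearMap.toSpanSingleton k B D.one))
    (h := (TensorProduct.rid k M).toLinearMap) fun m c => ?_)
  simp [hM.ract_one]

lemma rcoactHom_coassoc :
    rcoactHom hB hM ≫ rcoactHom hB hM ▷ ofYD hB.yd ≫ (α_ _ _ _).hom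
      = rcoactHom hB hM ≫ ofYD hM.yd ◁ comulHom hB := by
  refine hom_ext (LinearMap.ext fun m => ?_)
  change assocMap Q actM D.act D.act (rcoact.rTensor B (rcoact m))
    = D.comul.lTensor M (rcoact m)
  rw [← (TensorProduct.assoc k M B B).symm.injective.eq_iff, ← hM.rcoact_coassoc]
  generalize rcoact.rTensor B (rcoact m) = t
  rw [← LinearMap.sum_apply, ← LinearEquiv.coe_coe, ← LinearMap.comp_apply]
  refine LinearMap.congr_fun (TensorProduct.ext_threefold fun x b b' => ?_) t
  simp

lemma rcoactHom_counit :
    rcoactHom hB hM ≫ ofYD hM.yd ◁ counitHom hB = (ρ_ (ofYD hM.yd)).inv := by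
  refine hom_ext (LinearMap.ext fun m => (TensorProduct.rid k M).injective ?_)
  exact (hM.rcoact_counit m).trans ((TensorProduct.rid k M).apply_symm_apply m).symm

lemma ractHom_comp_rcoactHom :
    ractHom hB hM ≫ rcoactHom hB hM
      = rcoactHom hB hM ▷ ofYD hB.yd ≫ (ofYD hM.yd ⊗ ofYD hB.yd) ◁ comulHom hB ≫
        middleSwap (braidHom hB) (ofYD hM.yd) ≫ (ractHom hB hM ⊗ₘ mulHom hB) := by
  rw [← MonoidalCategory.tensorHom_def_assoc]
  exact hom_ext (rcoact_comp_ract hB hM)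

end Module

end HopfModule

end QuasiHopfModule

/-- Theorem 4.3 (ii): for a quasi-Hopf algebra `H`, a Hopf algebra `B` in the
braided category of left Yetter-Drinfeld modules over `H` and a right `B`-Hopf
module `M`, the map `P(m) = ∑ m₍0₎ ← S̲(m₍1₎)` takes values in the coinvariants
`M^{co B} = {m ∈ M | ρ_M(m) = m ⊗ 1_B}`. -/
theorem coinvProj_mem_coinvariants {k H : Type} [Field k] [Ring H] [Algebra k H]
    (Q : QuasiHopf k H) {B : Type} [AddCommGroup B] [Module k B]
    (D : BialgData Q.toQuasiBialgebra B) (Sb : B →ₗ[k] B)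
    (hB : IsBraidedHopf Q.toQuasiBialgebra D Sb)
    {M : Type} [AddCommGroup M] [Module k M]
    (actM : H →ₗ[k] M →ₗ[k] M) (coactM : M →ₗ[k] H ⊗[k] M)
    (ract : B →ₗ[k] M →ₗ[k] M) (rcoact : M →ₗ[k] M ⊗[k] B)
    (hM : IsRightBHopfModule Q.toQuasiBialgebra D actM coactM ract rcoact) :
    ∀ m : M, coinvProj Sb ract rcoact m ∈ coinvariants D rcoact := by
  intro m
  open QuasiHopfModule in
  have key := proj_comp_coaction (ractHom_assoc hB.bialg hM) (ractHom_one hB.bialg hM)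
    (mulHom_comp_comulHom hB.bialg) (oneHom_comp_comulHom hB.bialg) (antipodeHom_left hB)
    (antipodeHom_right hB) (rcoactHom_coassoc hB.bialg hM) (rcoactHom_counit hB.bialg hM)
    (ractHom_comp_rcoactHom hB.bialg hM)
  have hP : coinvProj Sb ract rcoact
      = TensorProduct.lift ract.flip ∘ₗ Sb.lTensor M ∘ₗ rcoact := by
    rw [coinvProj, ← LinearMap.comp_assoc]
    congr 1
    exact TensorProduct.ext' fun x b => by simp
  have hm := LinearMap.congr_fun (congrArg QuasiHopfModule.QRep.Hom.lin key) m
  rw [coinvariants, LinearMap.mem_ker, LinearMap.sub_apply, sub_eq_zero, hP]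
  refine hm.trans ?_
  change TensorProduct.map LinearMap.id (LinearMap.toSpanSingleton k B D.one)
    ((TensorProduct.rid k M).symm _) = _
  rw [TensorProduct.rid_symm_apply, TensorProduct.map_tmul, LinearMap.toSpanSingleton_apply_one]
  rfl
end
end

section
/- Let H be a quasi-Hopf algebra over a field k, B a Hopf algebra in the braided category of left Yetter–Drinfeld modules over H, and M a right B-Hopf module in this category, with coinvariants M^coB = {m∈M : ρ_M(m)=m⊗1_B} and P(m)=∑m_⟨0⟩←S̲(m_⟨1⟩). Then for all n∈M^coB and b∈B: ρ_M(n←b) = ∑ (x¹·n)←(x²·b_⟨1⟩) ⊗ x³·b_⟨2⟩, and P(n←b) = ε_B(b)·n, where Φ⁻¹=∑x¹⊗x²⊗x³. -/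
open scoped TensorProduct

noncomputable section

namespace QuasiBialgebra

variable {k H : Type} [Field k] [Ring H] [Algebra k H] (Q : QuasiBialgebra k H)

/-- the algebra map `ε ⊗ id : H ⊗ A → A` -/
def counitLeft (A : Type) [Ring A] [Algebra k A] : H ⊗[k] A →ₐ[k] A :=
  (Algebra.TensorProduct.lid k A).toAlgHom.comp
    (Algebra.TensorProduct.map Q.ε (AlgHom.id k A))

@[simp]
theorem counitLeft_tmul {A : Type} [Ring A] [Algebra k A] (h : H) (a : A) :
    Q.counitLeft A (h ⊗ₜ[k] a) = Q.ε h • a := by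
  simp [counitLeft]

theorem sum_counit_mul_counit (h : H) : ∑ j, Q.ε (Q.Δ1 h j) * Q.ε (Q.Δ2 h j) = Q.ε h := by
  simpa using congrArg Q.ε (Q.counit_left h)

theorem sum_counit_X1_counit_X2_smul_X3 :
    ∑ i, (Q.ε (Q.X1 i) * Q.ε (Q.X2 i)) • Q.X3 i = 1 := by
  have h := congrArg (Q.counitLeft H) Q.Φ_normal
  simpa [smul_smul, mul_comm] using h

/-- `(ε ⊗ id ⊗ id)(Φ) = 1` -/
theorem counitLeft_Φ : ∑ i, Q.ε (Q.X1 i) • (Q.X2 i ⊗ₜ[k] Q.X3 i) = (1 : H ⊗[k] H) := by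
  set E := ∑ i, Q.ε (Q.X1 i) • (Q.X2 i ⊗ₜ[k] Q.X3 i) with hE
  have hinv : E * Q.counitLeft _ (∑ a, Q.x1 a ⊗ₜ[k] (Q.x2 a ⊗ₜ[k] Q.x3 a)) = 1 := by
    have h := congrArg (Q.counitLeft (H ⊗[k] H)) Q.Φ_right_inv
    rw [map_mul, map_one] at h
    simpa [hE] using h
  have h1 : Q.counitLeft _ (Q.counitLeft _
      (∑ i, (1 : H) ⊗ₜ[k] (Q.X1 i ⊗ₜ[k] (Q.X2 i ⊗ₜ[k] Q.X3 i)))) = E := by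
    simp [hE]
  have h2 : Q.counitLeft _ (Q.counitLeft _ (∑ i, ∑ j, Q.X1 i ⊗ₜ[k]
      (Q.Δ1 (Q.X2 i) j ⊗ₜ[k] (Q.Δ2 (Q.X2 i) j ⊗ₜ[k] Q.X3 i)))) = E := by
    simp only [map_sum, counitLeft_tmul, map_smul, hE, ← Finset.smul_sum]
    simp only [TensorProduct.smul_tmul', ← TensorProduct.sum_tmul, Q.counit_left]
  have h3 : Q.counitLeft _ (Q.counitLeft _
      (∑ i, Q.X1 i ⊗ₜ[k] (Q.X2 i ⊗ₜ[k] (Q.X3 i ⊗ₜ[k] (1 : H))))) = 1 := by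
    simp only [map_sum, counitLeft_tmul, map_smul, smul_smul]
    simp only [TensorProduct.smul_tmul', ← TensorProduct.sum_tmul,
      Q.sum_counit_X1_counit_X2_smul_X3]
    rfl
  have h4 : Q.counitLeft _ (Q.counitLeft _ (∑ i, ∑ j, Q.X1 i ⊗ₜ[k]
      (Q.X2 i ⊗ₜ[k] (Q.Δ1 (Q.X3 i) j ⊗ₜ[k] Q.Δ2 (Q.X3 i) j)))) = 1 := by
    simp only [map_sum, counitLeft_tmul, map_smul, smul_smul, ← Finset.smul_sum, ← Q.Δ_eq]
    simp only [← map_smul, ← map_sum, Q.sum_counit_X1_counit_X2_smul_X3, map_one]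
  have h5 : Q.counitLeft _ (Q.counitLeft _ (∑ i, ∑ j, Q.Δ1 (Q.X1 i) j ⊗ₜ[k]
      (Q.Δ2 (Q.X1 i) j ⊗ₜ[k] (Q.X2 i ⊗ₜ[k] Q.X3 i)))) = E := by
    simp only [map_sum, counitLeft_tmul, map_smul, smul_smul, ← Finset.sum_smul,
      Q.sum_counit_mul_counit, hE]
  have h := congrArg (fun z => Q.counitLeft _ (Q.counitLeft _ z)) Q.cocycle
  simp only [map_mul] at h
  rw [h1, h2, h3, h4, h5, mul_one, one_mul] at h
  calc E = E * (E * Q.counitLeft _ (∑ a, Q.x1 a ⊗ₜ[k] (Q.x2 a ⊗ₜ[k] Q.x3 a))) := by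
        rw [hinv, mul_one]
    _ = 1 := by rw [← mul_assoc, h, hinv]

/-- `(ε ⊗ id ⊗ id)(Φ⁻¹) = 1` -/
theorem counitLeft_Φ_inv :
    ∑ a, Q.ε (Q.x1 a) • (Q.x2 a ⊗ₜ[k] Q.x3 a) = (1 : H ⊗[k] H) := by
  have h := congrArg (Q.counitLeft (H ⊗[k] H)) Q.Φ_left_inv
  rw [map_mul, map_one] at h
  simpa [Q.counitLeft_Φ] using h

theorem sum_counit_X2_smul_X1_tmul_comul_X3 :
    ∑ i, ∑ j, Q.ε (Q.X2 i) • (Q.X1 i ⊗ₜ[k] (Q.Δ1 (Q.X3 i) j ⊗ₜ[k] Q.Δ2 (Q.X3 i) j))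
      = (1 : H ⊗[k] (H ⊗[k] H)) := by
  have h := congrArg (Algebra.TensorProduct.map (AlgHom.id k H) Q.Δmap) Q.Φ_normal
  rw [map_one] at h
  simpa [Q.Δ_eq, TensorProduct.tmul_sum, Finset.smul_sum] using h

/-- The reassociators in the braided formula for `ρ_M(m ← b)` collapse to `Φ⁻¹` once the counit
is applied to the legs acting on `m₍1₎`. -/
theorem sum_counit_smul_reassociators :
    ∑ a, ∑ i, ∑ i2, ∑ a2, ∑ j, ∑ j2,
      (Q.ε (Q.x1 a2 * Q.X2 i) * Q.ε (Q.Δ1 (Q.x3 a) j2 * Q.X2 i2)) •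
        ((Q.x1 a * Q.X1 i) ⊗ₜ[k]
          ((Q.x2 a * Q.X1 i2 * (Q.x2 a2 * Q.Δ1 (Q.X3 i) j)) ⊗ₜ[k]
            (Q.Δ2 (Q.x3 a) j2 * Q.X3 i2 * Q.x3 a2 * Q.Δ2 (Q.X3 i) j)))
      = ∑ a, Q.x1 a ⊗ₜ[k] (Q.x2 a ⊗ₜ[k] Q.x3 a) := by
  refine Finset.sum_congr rfl fun a _ => ?_
  have hx : ∑ j2, Q.ε (Q.Δ1 (Q.x3 a) j2) • (Q.x1 a ⊗ₜ[k] (Q.x2 a ⊗ₜ[k] Q.Δ2 (Q.x3 a) j2))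
      = Q.x1 a ⊗ₜ[k] (Q.x2 a ⊗ₜ[k] Q.x3 a) := by
    simp only [← TensorProduct.tmul_smul, ← TensorProduct.tmul_sum, Q.counit_left]
  have hX : ∑ i2, Q.ε (Q.X2 i2) • ((1 : H) ⊗ₜ[k] (Q.X1 i2 ⊗ₜ[k] Q.X3 i2)) = 1 := by
    simpa [Algebra.TensorProduct.one_def] using
      congrArg (TensorProduct.mk k H (H ⊗[k] H) 1) Q.Φ_normal
  have hY : ∑ a2, Q.ε (Q.x1 a2) • ((1 : H) ⊗ₜ[k] (Q.x2 a2 ⊗ₜ[k] Q.x3 a2)) = 1 := by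
    simpa [Algebra.TensorProduct.one_def] using
      congrArg (TensorProduct.mk k H (H ⊗[k] H) 1) Q.counitLeft_Φ_inv
  have key := congrArg₂ (· * ·) hx (congrArg₂ (· * ·) hX (congrArg₂ (· * ·) hY
    Q.sum_counit_X2_smul_X1_tmul_comul_X3))
  simp only [mul_one] at key
  rw [← key]
  simp only [Finset.sum_mul, Finset.mul_sum, smul_mul_smul_comm,
    Algebra.TensorProduct.tmul_mul_tmul]
  refine Finset.sum_congr rfl fun i _ => Finset.sum_comm_cycle.trans ?_
  refine Finset.sum_congr rfl fun j _ => Finset.sum_comm.trans ?_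
  refine Finset.sum_congr rfl fun a2 _ => Finset.sum_congr rfl fun i2 _ =>
    Finset.sum_congr rfl fun j2 _ => ?_
  simp only [one_mul, map_mul, mul_assoc]
  congr 1
  ring

end QuasiBialgebra

/-- Theorem 4.3 (iii): for a right `B`-Hopf module `M` in the braided category
of left Yetter-Drinfeld modules over a quasi-Hopf algebra `H`, for every
coinvariant `n ∈ M^{co B}` and every `b ∈ B`:
`ρ_M(n←b) = ∑ (x¹·n)←(x²·b₍1₎) ⊗ x³·b₍2₎` and `P(n←b) = ε_B(b) n`. -/
theorem rcoact_ract_coinvariant {k H : Type} [Field k] [Ring H] [Algebra k H]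
    (Q : QuasiHopf k H) {B : Type} [AddCommGroup B] [Module k B]
    (D : BialgData Q.toQuasiBialgebra B) (Sb : B →ₗ[k] B)
    (hB : IsBraidedHopf Q.toQuasiBialgebra D Sb)
    {M : Type} [AddCommGroup M] [Module k M]
    (actM : H →ₗ[k] M →ₗ[k] M) (coactM : M →ₗ[k] H ⊗[k] M)
    (ract : B →ₗ[k] M →ₗ[k] M) (rcoact : M →ₗ[k] M ⊗[k] B)
    (hM : IsRightBHopfModule Q.toQuasiBialgebra D actM coactM ract rcoact) :
    ∀ n ∈ coinvariants D rcoact, ∀ b : B,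
      (rcoact (ract b n)
        = ∑ a, ∑ l, (ract (D.act (Q.x2 a) (D.D1 b l)) (actM (Q.x1 a) n))
            ⊗ₜ[k] (D.act (Q.x3 a) (D.D2 b l))) ∧
      coinvProj Sb ract rcoact (ract b n) = D.counit b • n := by
  intro n hn b
  have hn' : rcoact n = n ⊗ₜ[k] D.one := by
    simpa [coinvariants, sub_eq_zero] using hn
  have hρ : rcoact (ract b n)
      = ∑ a, ∑ l, (ract (D.act (Q.x2 a) (D.D1 b l)) (actM (Q.x1 a) n))
          ⊗ₜ[k] (D.act (Q.x3 a) (D.D2 b l)) := by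
    let T (l : D.LB) : H ⊗[k] (H ⊗[k] H) →ₗ[k] M ⊗[k] B :=
      (TensorProduct.map
        (TensorProduct.lift ((ract.comp (D.act.flip (D.D1 b l))).flip.comp (actM.flip n)))
        (D.act.flip (D.D2 b l))).comp (TensorProduct.assoc k H H H).symm.toLinearMap
    have hT (l : D.LB) (g h h' : H) : T l (g ⊗ₜ[k] (h ⊗ₜ[k] h'))
        = ract (D.act h (D.D1 b l)) (actM g n) ⊗ₜ[k] D.act h' (D.D2 b l) := rfl
    have key := congrArg (⇑(∑ l, T l)) Q.sum_counit_smul_reassociators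
    simp only [map_sum, map_smul, LinearMap.sum_apply, hT, Finset.smul_sum] at key
    rw [← key, hM.rcoact_ract, hn']
    simp only [LinearMap.lTensor_tmul, LinearMap.comp_apply, hB.bialg.act_one, map_smul,
      hB.bialg.coact_one, TensorProduct.tmul_smul, TensorProduct.assoc_symm_tmul,
      TensorProduct.map_tmul, TensorProduct.lift.tmul, LinearMap.flip_apply, lrH,
      LinearMap.mulLeft_apply, LinearMap.mulRight_apply, one_mul,
      hB.bialg.one_mul, smul_smul]
  refine ⟨hρ, ?_⟩
  let U (l : D.LB) : H ⊗[k] (H ⊗[k] H) →ₗ[k] M :=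
    (TensorProduct.lift (ract.flip.comp (actM.flip n))).comp
      (LinearMap.lTensor H (TensorProduct.lift
        ((D.mul.comp (D.act.flip (D.D1 b l))).compl₂ (D.act.flip (Sb (D.D2 b l))))))
  have hU (l : D.LB) (g h h' : H) : U l (g ⊗ₜ[k] (h ⊗ₜ[k] h'))
      = ract (D.mul (D.act h (D.D1 b l)) (D.act h' (Sb (D.D2 b l)))) (actM g n) := rfl
  have key := congrArg (⇑(∑ l, U l)) Q.Φ_right_inv
  simp only [Finset.sum_mul, Finset.mul_sum, Algebra.TensorProduct.tmul_mul_tmul, map_sum,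
    Algebra.TensorProduct.one_def, LinearMap.sum_apply, hU, hM.yd.one_act, hB.bialg.yd.one_act,
    LinearMap.id_apply] at key
  simp only [← LinearMap.sum_apply, ← map_sum, hB.antipode_right] at key
  rw [map_smul, LinearMap.smul_apply, hM.ract_one] at key
  rw [← key, coinvProj, LinearMap.comp_apply, hρ]
  simp only [map_sum, TensorProduct.lift.tmul, LinearMap.flip_apply, LinearMap.comp_apply,
    hB.antipode_Hlinear, hM.ract_assoc, hM.yd.mul_act, hB.bialg.yd.mul_act]
  simp only [LinearMap.sum_apply]
  exact Finset.sum_congr rfl fun a _ => Finset.sum_comm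
end
end
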